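/- arXiv:1404.2335 — 11 statements merged into one kernel-verified Lean document; each statement's English description precedes it below -/
import Mathlib

section
/- Let N > M be positive integers and let f_1,…,f_N ∈ ℝ^M. Then {f_n}_{n=1}^N is a Parseval frame for ℝ^M if and only if there exist vectors ψ_1,…,ψ_N ∈ ℝ^{N−M} such that the vectors f_n ⊕ ψ_n (n = 1,…,N) form an orthonormal basis of ℝ^M × ℝ^{N−M} ≅ ℝ^N. Moreover, in that case {ψ_n}_{n=1}^N is a Parseval frame for ℝ^{N−M} (the Naimark complement), and if {ψ'_n}_{n=1}^N is another family with the same property, then there exists a unique linear operator L on ℝ^{N−M} with L ψ_n = ψ'_n for all n = 1,…,N, and L is unitary. -/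
open scoped RealInnerProductSpace

/-- The combined vectors `f n ⊕ ψ n` in `ℝ^M × ℝ^{N-M}` (with the ℓ² product inner product). -/
noncomputable def naimarkEmbed (M N : ℕ) (f : Fin N → EuclideanSpace ℝ (Fin M))
    (ψ : Fin N → EuclideanSpace ℝ (Fin (N - M))) (n : Fin N) :
    WithLp 2 (EuclideanSpace ℝ (Fin M) × EuclideanSpace ℝ (Fin (N - M))) :=
  (WithLp.equiv 2 (EuclideanSpace ℝ (Fin M) × EuclideanSpace ℝ (Fin (N - M)))).symm (f n, ψ n)

/-- `f n ⊕ ψ n` (n = 1,…,N) forms an orthonormal basis of `ℝ^M × ℝ^{N-M} ≅ ℝ^N`. -/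
def NaimarkONB (M N : ℕ) (f : Fin N → EuclideanSpace ℝ (Fin M))
    (ψ : Fin N → EuclideanSpace ℝ (Fin (N - M))) : Prop :=
  Orthonormal ℝ (naimarkEmbed M N f ψ) ∧
    Submodule.span ℝ (Set.range (naimarkEmbed M N f ψ)) = ⊤

lemma inner_naimarkEmbed {M N : ℕ} (f : Fin N → EuclideanSpace ℝ (Fin M))
    (ψ : Fin N → EuclideanSpace ℝ (Fin (N - M))) (m n : Fin N) :
    ⟪naimarkEmbed M N f ψ m, naimarkEmbed M N f ψ n⟫ = ⟪f m, f n⟫ + ⟪ψ m, ψ n⟫ := by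
  simp [naimarkEmbed, WithLp.prod_inner_apply]

namespace NaimarkONB

variable {M N : ℕ} {f : Fin N → EuclideanSpace ℝ (Fin M)}
  {ψ ψ' : Fin N → EuclideanSpace ℝ (Fin (N - M))}

lemma sum_inner_smul (h : NaimarkONB M N f ψ)
    (w : WithLp 2 (EuclideanSpace ℝ (Fin M) × EuclideanSpace ℝ (Fin (N - M)))) :
    ∑ n, ⟪naimarkEmbed M N f ψ n, w⟫ • naimarkEmbed M N f ψ n = w := by
  simpa using (OrthonormalBasis.mk h.1 h.2.ge).sum_repr' w

lemma sum_inner_smul_left (h : NaimarkONB M N f ψ) (x : EuclideanSpace ℝ (Fin M)) :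
    ∑ n, ⟪x, f n⟫ • f n = x := by
  have h2 := congrArg (WithLp.fstL 2 ℝ _ _) (h.sum_inner_smul (WithLp.toLp 2 (x, 0)))
  simpa [map_sum, naimarkEmbed, WithLp.prod_inner_apply, real_inner_comm] using h2

lemma sum_inner_smul_right (h : NaimarkONB M N f ψ) (y : EuclideanSpace ℝ (Fin (N - M))) :
    ∑ n, ⟪y, ψ n⟫ • ψ n = y := by
  have h2 := congrArg (WithLp.sndL 2 ℝ _ _) (h.sum_inner_smul (WithLp.toLp 2 (0, y)))
  simpa [map_sum, naimarkEmbed, WithLp.prod_inner_apply, real_inner_comm] using h2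

/-- Two families completing the same vectors have the same Gram matrix. -/
lemma inner_eq_inner (h : NaimarkONB M N f ψ) (h' : NaimarkONB M N f ψ') (m n : Fin N) :
    ⟪ψ m, ψ n⟫ = ⟪ψ' m, ψ' n⟫ := by
  have h1 := orthonormal_iff_ite.mp h.1 m n
  have h2 := orthonormal_iff_ite.mp h'.1 m n
  rw [inner_naimarkEmbed] at h1 h2
  linarith

end NaimarkONB

/-- Families with the same Gram matrix, the first of which is a Parseval frame, are related by
a linear isometry. -/
lemma exists_linearIsometry_of_inner_eq {ι E F : Type*} [Fintype ι]
    [NormedAddCommGroup E] [InnerProductSpace ℝ E] [NormedAddCommGroup F] [InnerProductSpace ℝ F]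
    {v : ι → E} {w : ι → F} (hv : ∀ x, ∑ n, ⟪x, v n⟫ • v n = x)
    (hw : ∀ x, ∑ n, ⟪x, w n⟫ • w n = x) (hvw : ∀ m n, ⟪v m, v n⟫ = ⟪w m, w n⟫) :
    ∃ L : E →ₗᵢ[ℝ] F, ∀ n, L (v n) = w n := by
  let L : E →ₗ[ℝ] F := ∑ n, (innerₗ E (v n)).smulRight (w n)
  have hL (x : E) : L x = ∑ n, ⟪x, v n⟫ • w n := by
    simp [L, real_inner_comm]
  refine ⟨L.isometryOfInner fun x y => ?_, fun m => ?_⟩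
  · conv_rhs => rw [← hv x, ← hv y]
    simp only [hL, sum_inner, inner_sum, real_inner_smul_left, real_inner_smul_right, hvw]
  · simp only [LinearMap.coe_isometryOfInner, hL, hvw, hw]

/-- The analysis operator of a Parseval frame, as a linear isometry. -/
noncomputable def parsevalAnalysis {ι E : Type*} [Fintype ι]
    [NormedAddCommGroup E] [InnerProductSpace ℝ E]
    (v : ι → E) (hv : ∀ x, ∑ n, ⟪x, v n⟫ • v n = x) : E →ₗᵢ[ℝ] EuclideanSpace ℝ ι :=
  ((WithLp.linearEquiv 2 ℝ (ι → ℝ)).symm.toLinearMap ∘ₗ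
    LinearMap.pi fun n => innerₗ E (v n)).isometryOfInner fun x y => by
      conv_rhs => rw [← hv x]
      simp only [sum_inner, real_inner_smul_left]
      simp [PiLp.inner_apply, real_inner_comm, mul_comm]

lemma parsevalAnalysis_apply {ι E : Type*} [Fintype ι]
    [NormedAddCommGroup E] [InnerProductSpace ℝ E]
    (v : ι → E) (hv : ∀ x, ∑ n, ⟪x, v n⟫ • v n = x) (x : E) (n : ι) :
    parsevalAnalysis v hv x n = ⟪v n, x⟫ := rfl

/-- A linear isometry defined on one summand extends to an isometric equivalence, provided the
dimensions match. -/
lemma exists_linearIsometryEquiv_extend_inl {E F G : Type*}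
    [NormedAddCommGroup E] [InnerProductSpace ℝ E] [FiniteDimensional ℝ E]
    [NormedAddCommGroup F] [InnerProductSpace ℝ F] [FiniteDimensional ℝ F]
    [NormedAddCommGroup G] [InnerProductSpace ℝ G] [FiniteDimensional ℝ G]
    (hd : Module.finrank ℝ (WithLp 2 (E × F)) = Module.finrank ℝ G) (T : E →ₗᵢ[ℝ] G) :
    ∃ U : WithLp 2 (E × F) ≃ₗᵢ[ℝ] G, ∀ x, U (WithLp.toLp 2 (x, 0)) = T x := by
  let i : E →ₗᵢ[ℝ] WithLp 2 (E × F) :=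
    ((WithLp.linearEquiv 2 ℝ (E × F)).symm.toLinearMap ∘ₗ
      LinearMap.inl ℝ E F).isometryOfInner fun x y => by simp [WithLp.prod_inner_apply]
  let Φ : WithLp 2 (E × F) ≃ₗᵢ[ℝ] G :=
    (stdOrthonormalBasis ℝ _).equiv (stdOrthonormalBasis ℝ _) (finCongr hd)
  let L := (Φ.symm.toLinearIsometry.comp T).comp i.equivRange.symm.toLinearIsometry
  refine ⟨(L.extend.toLinearIsometryEquiv rfl).trans Φ, fun x => ?_⟩
  have h : L.extend (i.equivRange x) = Φ.symm (T x) := by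
    rw [LinearIsometry.extend_apply]
    simp [L]
  change Φ (L.extend (i.equivRange x)) = T x
  rw [h, Φ.apply_symm_apply]

lemma exists_naimarkONB {M N : ℕ} (hMN : M ≤ N) {f : Fin N → EuclideanSpace ℝ (Fin M)}
    (hf : ∀ x, ∑ n, ⟪x, f n⟫ • f n = x) :
    ∃ ψ : Fin N → EuclideanSpace ℝ (Fin (N - M)), NaimarkONB M N f ψ := by
  have hd : Module.finrank ℝ
      (WithLp 2 (EuclideanSpace ℝ (Fin M) × EuclideanSpace ℝ (Fin (N - M)))) =
      Module.finrank ℝ (EuclideanSpace ℝ (Fin N)) := by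
    rw [(WithLp.linearEquiv 2 ℝ _).finrank_eq]
    simp [hMN]
  obtain ⟨U, hU⟩ := exists_linearIsometryEquiv_extend_inl hd (parsevalAnalysis f hf)
  let b := (EuclideanSpace.basisFun (Fin N) ℝ).map U.symm
  have hb : naimarkEmbed M N f (fun n => (b n).snd) = b := by
    funext n
    have hfst : (b n).fst = f n := by
      refine ext_inner_right ℝ fun x => ?_
      have h1 : ⟪b n, WithLp.toLp 2 (x, 0)⟫ = ⟪(b n).fst, x⟫ := by
        simp [WithLp.prod_inner_apply]
      rw [← h1, ← U.inner_map_map, hU]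
      simp [b, parsevalAnalysis_apply, EuclideanSpace.inner_single_left]
    simp only [naimarkEmbed, ← hfst]
    rfl
  refine ⟨fun n => (b n).snd, ?_⟩
  rw [NaimarkONB, hb]
  refine ⟨b.orthonormal, ?_⟩
  rw [← b.coe_toBasis]
  exact b.toBasis.span_eq

/-- Naimark's theorem together with the Naimark complement statements. -/
theorem stmt_1 (M N : ℕ) (hMN : M < N)
    (f : Fin N → EuclideanSpace ℝ (Fin M)) :
    ((∀ x : EuclideanSpace ℝ (Fin M), ∑ n, ⟪x, f n⟫ • f n = x)
      ↔ ∃ ψ : Fin N → EuclideanSpace ℝ (Fin (N - M)), NaimarkONB M N f ψ) ∧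
    (∀ ψ : Fin N → EuclideanSpace ℝ (Fin (N - M)), NaimarkONB M N f ψ →
      ∀ x : EuclideanSpace ℝ (Fin (N - M)), ∑ n, ⟪x, ψ n⟫ • ψ n = x) ∧
    (∀ ψ ψ' : Fin N → EuclideanSpace ℝ (Fin (N - M)),
      NaimarkONB M N f ψ → NaimarkONB M N f ψ' →
      ∃ L : EuclideanSpace ℝ (Fin (N - M)) →ₗ[ℝ] EuclideanSpace ℝ (Fin (N - M)),
        (∀ n, L (ψ n) = ψ' n) ∧
        (∃ U : EuclideanSpace ℝ (Fin (N - M)) ≃ₗᵢ[ℝ] EuclideanSpace ℝ (Fin (N - M)),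
          ∀ x, U x = L x) ∧
        ∀ L' : EuclideanSpace ℝ (Fin (N - M)) →ₗ[ℝ] EuclideanSpace ℝ (Fin (N - M)),
          (∀ n, L' (ψ n) = ψ' n) → L' = L) := by
  refine ⟨⟨exists_naimarkONB hMN.le, fun ⟨_, h⟩ => h.sum_inner_smul_left⟩,
    fun _ h => h.sum_inner_smul_right, fun ψ ψ' h h' => ?_⟩
  obtain ⟨L, hL⟩ := exists_linearIsometry_of_inner_eq h.sum_inner_smul_right
    h'.sum_inner_smul_right (h.inner_eq_inner h')
  refine ⟨L.toLinearMap, hL, ⟨L.toLinearIsometryEquiv rfl, fun _ => rfl⟩, fun L' hL' => ?_⟩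
  ext1 x
  rw [← h.sum_inner_smul_right x, map_sum, map_sum]
  simp [hL, hL']
end

section
/- (Schur–Horn Theorem) Let S be a positive, self-adjoint operator on ℝ^M with eigenvalues λ_1 ≥ λ_2 ≥ … ≥ λ_M > 0 (counted with multiplicity), let N ≥ M, and let a_1 ≥ a_2 ≥ … ≥ a_N be positive real numbers. Then the following are equivalent: (1) there exists a frame {f_n}_{n=1}^N for ℝ^M having frame operator S and satisfying ‖f_n‖ = a_n for all n = 1,…,N; (2) for every k with 1 ≤ k ≤ M one has Σ_{j=1}^k a_j² ≤ Σ_{j=1}^k λ_j, and Σ_{j=1}^N a_j² = Σ_{j=1}^M λ_j. -/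
open scoped RealInnerProductSpace

/-- Two functions that agree off a pair of points and have the same sum over that pair have the
same sum over any finset containing the pair. -/
theorem Finset.sum_eq_sum_of_pair {ι V : Type*} [DecidableEq ι] [AddCommMonoid V] {s : Finset ι}
    {i j : ι} (hij : i ≠ j) (hi : i ∈ s) (hj : j ∈ s) {g h : ι → V}
    (hpair : g i + g j = h i + h j) (hoff : ∀ l, l ≠ i → l ≠ j → g l = h l) :
    ∑ l ∈ s, g l = ∑ l ∈ s, h l := by
  have hsub : ({i, j} : Finset ι) ⊆ s := by
    simp [Finset.insert_subset_iff, hi, hj]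
  rw [← Finset.sum_sdiff hsub, ← Finset.sum_sdiff hsub, Finset.sum_pair hij, Finset.sum_pair hij,
    hpair]
  congr 1
  refine Finset.sum_congr rfl fun l hl => ?_
  simp only [Finset.mem_sdiff, Finset.mem_insert, Finset.mem_singleton, not_or] at hl
  exact hoff l hl.2.1 hl.2.2

/-- A set of real vectors is closed under transfers from a larger entry to a smaller one. -/
def IsTransferClosed {ι : Type*} (R : Set (ι → ℝ)) : Prop :=
  ∀ x ∈ R, ∀ y : ι → ℝ, ∀ i j, i ≠ j → (∀ l, l ≠ i → l ≠ j → y l = x l) →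
    y i + y j = x i + x j → x j ≤ y i → y i ≤ x i → y ∈ R

/-- Hardy–Littlewood–Pólya: a decreasing vector whose partial sums are dominated by those of `x`,
with equal total, is reached from `x` by transfers. -/
theorem IsTransferClosed.mem_of_sum_Iic_le {ι : Type*} [Fintype ι] [LinearOrder ι]
    [LocallyFiniteOrderBot ι] {R : Set (ι → ℝ)} (hR : IsTransferClosed R) {d : ι → ℝ}
    (hd : Antitone d) {x : ι → ℝ} (hx : x ∈ R)
    (hle : ∀ k, ∑ i ∈ Finset.Iic k, d i ≤ ∑ i ∈ Finset.Iic k, x i)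
    (htot : ∑ i, d i = ∑ i, x i) : d ∈ R := by
  induction hn : (Finset.univ.filter fun i => d i ≠ x i).card using Nat.strong_induction_on
    generalizing x with
  | _ n ih =>
  by_cases hdx : ∀ i, d i ≤ x i
  · have h := (Finset.sum_eq_sum_iff_of_le fun i _ => hdx i).1 htot
    have : d = x := funext fun i => h i (Finset.mem_univ i)
    exact this ▸ hx
  push Not at hdx
  obtain ⟨k, hk, hkmin⟩ : ∃ k, x k < d k ∧ ∀ i < k, d i ≤ x i := by
    have hne : (Finset.univ.filter fun i => x i < d i).Nonempty := by
      obtain ⟨i, hi⟩ := hdx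
      exact ⟨i, by simpa using hi⟩
    refine ⟨Finset.min' _ hne, by simpa using Finset.min'_mem _ hne, fun i hi => ?_⟩
    by_contra! h
    exact absurd (Finset.min'_le _ i (by simpa using h)) (not_le.2 hi)
  obtain ⟨j, hjk, hj⟩ : ∃ j < k, d j < x j := by
    by_contra! h
    refine absurd (hle k) (not_le.2 (Finset.sum_lt_sum (fun i hi => ?_) ⟨k, by simp, hk⟩))
    rcases (Finset.mem_Iic.1 hi).lt_or_eq with h' | rfl
    · exact h i h'
    · exact hk.le
  have hdjk := hd hjk.le
  obtain ⟨δ, hδj, hδk, hδ0, hδ⟩ : ∃ δ, δ ≤ x j - d j ∧ δ ≤ d k - x k ∧ 0 ≤ δ ∧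
      (δ = x j - d j ∨ δ = d k - x k) :=
    ⟨min (x j - d j) (d k - x k), min_le_left _ _, min_le_right _ _,
      le_min (by linarith) (by linarith), min_choice _ _⟩
  set y : ι → ℝ := Function.update (Function.update x j (x j - δ)) k (x k + δ) with hy
  have hyk : y k = x k + δ := by simp [hy]
  have hyj : y j = x j - δ := by simp [hy, hjk.ne]
  have hyoff : ∀ l, l ≠ j → l ≠ k → y l = x l := fun l h1 h2 => by simp [hy, h1, h2]
  have hpair : y j + y k = x j + x k := by rw [hyj, hyk]; ring
  refine ih _ ?_ (hR x hx y j k hjk.ne hyoff hpair (by linarith) (by linarith))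
    (fun l => ?_) ?_ rfl
  · rw [← hn]
    refine Finset.card_lt_card (Finset.ssubset_iff_of_subset ?_ |>.2 ?_)
    · intro l
      simp only [Finset.mem_filter, Finset.mem_univ, true_and]
      intro h
      by_cases h1 : l = j
      · subst h1; exact hj.ne
      by_cases h2 : l = k
      · subst h2; exact hk.ne'
      rwa [hyoff l h1 h2] at h
    · rcases hδ with h | h
      · exact ⟨j, by simpa using hj.ne, by simp [hyj, h]⟩
      · exact ⟨k, by simpa using hk.ne', by simp [hyk, h]⟩
  · rcases lt_or_ge l k with hlk | hkl
    · refine Finset.sum_le_sum fun i hi => ?_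
      have hik : i < k := (Finset.mem_Iic.1 hi).trans_lt hlk
      by_cases h1 : i = j
      · subst h1; linarith
      · rw [hyoff i h1 hik.ne]; exact hkmin i hik
    · rw [Finset.sum_eq_sum_of_pair hjk.ne (Finset.mem_Iic.2 (hjk.le.trans hkl))
        (Finset.mem_Iic.2 hkl) hpair hyoff]
      exact hle l
  · rw [Finset.sum_eq_sum_of_pair hjk.ne (Finset.mem_univ _) (Finset.mem_univ _) hpair hyoff]
    exact htot

/-- Some rotation in the plane of coefficients turns `u` into a vector of any prescribed squared
norm between those of `v` and `u`. -/
theorem exists_rotation_norm_sq_eq {E : Type*} [NormedAddCommGroup E] [InnerProductSpace ℝ E]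
    (u v : E) {t : ℝ} (hv : ‖v‖ ^ 2 ≤ t) (hu : t ≤ ‖u‖ ^ 2) :
    ∃ θ : ℝ, ‖Real.cos θ • u + Real.sin θ • v‖ ^ 2 = t := by
  have hcont : Continuous fun θ : ℝ => ‖Real.cos θ • u + Real.sin θ • v‖ ^ 2 := by fun_prop
  exact mem_range_of_exists_le_of_exists_ge hcont
    ⟨Real.pi / 2, by simpa using hv⟩ ⟨0, by simpa using hu⟩

/-- The squared-norm profiles of families indexed by `ι` with frame operator `S`. -/
def frameNormSq (ι : Type*) {E : Type*} [Fintype ι] [NormedAddCommGroup E]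
    [InnerProductSpace ℝ E] (S : E → E) : Set (ι → ℝ) :=
  {x | ∃ f : ι → E, (∀ v, ∑ n, ⟪v, f n⟫ • f n = S v) ∧ ∀ n, ‖f n‖ ^ 2 = x n}

/-- The squared-norm profiles of families with a prescribed frame operator are closed under
transfers. -/
theorem isTransferClosed_frameNormSq {ι E : Type*} [Fintype ι] [NormedAddCommGroup E]
    [InnerProductSpace ℝ E] (S : E → E) :
    IsTransferClosed (frameNormSq ι S) := by
  classical
  rintro x ⟨f, hfS, hfx⟩ y i j hij hoff hpair hji hii
  obtain ⟨θ, hθ⟩ := exists_rotation_norm_sq_eq (f i) (f j) (t := y i)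
    (by rw [hfx]; exact hji) (by rw [hfx]; exact hii)
  set c := Real.cos θ
  set s := Real.sin θ
  have hcs : c ^ 2 + s ^ 2 = 1 := Real.cos_sq_add_sin_sq θ
  set g : ι → E :=
    Function.update (Function.update f i (c • f i + s • f j)) j (c • f j - s • f i) with hg
  have hgj : g j = c • f j - s • f i := by simp [hg]
  have hgi : g i = c • f i + s • f j := by simp [hg, hij]
  have hgoff : ∀ l, l ≠ i → l ≠ j → g l = f l := fun l h1 h2 => by simp [hg, h1, h2]
  refine ⟨g, fun v => ?_, fun n => ?_⟩
  · rw [← hfS v]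
    refine Finset.sum_eq_sum_of_pair hij (Finset.mem_univ _) (Finset.mem_univ _) ?_
      fun l h1 h2 => by rw [hgoff l h1 h2]
    rw [hgi, hgj]
    simp only [inner_add_right, inner_sub_right, inner_smul_right]
    have hs : s ^ 2 = 1 - c ^ 2 := by linarith
    match_scalars <;> ring_nf <;> rw [hs] <;> ring
  · by_cases h1 : n = i
    · subst h1; rw [hgi, hθ]
    by_cases h2 : n = j
    · subst h2
      have hsum : ‖c • f i + s • f n‖ ^ 2 + ‖c • f n - s • f i‖ ^ 2
          = (c ^ 2 + s ^ 2) * (‖f i‖ ^ 2 + ‖f n‖ ^ 2) := by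
        rw [norm_add_sq_real, norm_sub_sq_real]
        simp only [norm_smul, mul_pow, Real.norm_eq_abs, sq_abs, inner_smul_left,
          inner_smul_right, real_inner_comm (f i) (f n), conj_trivial]
        ring
      rw [hθ, hcs, hfx, hfx] at hsum
      rw [hgj]
      linarith
    · rw [hgoff n h1 h2, hoff n h1 h2, hfx]

/-- A weighted sum of a decreasing sequence with weights in `[0, 1]` of total at most `k` is at
most the sum of the first `k` terms. -/
theorem sum_mul_le_sum_filter_lt {M : ℕ} {lam : Fin M → ℝ} (hpos : ∀ m, 0 ≤ lam m)
    (hmono : Antitone lam) {w : Fin M → ℝ} (hw0 : ∀ m, 0 ≤ w m) (hw1 : ∀ m, w m ≤ 1) {k : ℕ}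
    (hk : k ≤ M) (hwk : ∑ m, w m ≤ k) :
    ∑ m, lam m * w m ≤ ∑ m ∈ Finset.univ.filter (fun m : Fin M => (m : ℕ) < k), lam m := by
  rcases hk.eq_or_lt with rfl | hkM
  · simp only [Fin.is_lt, Finset.filter_true]
    exact Finset.sum_le_sum fun m _ => mul_le_of_le_one_right (hpos m) (hw1 m)
  set p := lam ⟨k, hkM⟩
  have hcard : ∑ m : Fin M, (if (m : ℕ) < k then (1 : ℝ) else 0) = k := by
    rw [Finset.sum_boole, Fin.card_filter_val_lt, min_eq_right hk]
  calc ∑ m, lam m * w m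
      ≤ ∑ m : Fin M, ((if (m : ℕ) < k then lam m else 0)
          + p * (w m - if (m : ℕ) < k then 1 else 0)) := by
        refine Finset.sum_le_sum fun m _ => ?_
        split_ifs with h
        · have : p ≤ lam m := hmono (Fin.le_def.2 h.le)
          nlinarith [hw1 m]
        · have : lam m ≤ p := hmono (Fin.le_def.2 (not_lt.1 h))
          nlinarith [hw0 m]
    _ = (∑ m ∈ Finset.univ.filter (fun m : Fin M => (m : ℕ) < k), lam m)
          + p * (∑ m, w m - k) := by
        rw [Finset.sum_add_distrib, ← Finset.mul_sum, Finset.sum_sub_distrib, hcard,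
          Finset.sum_filter]
    _ ≤ _ := by nlinarith [hpos ⟨k, hkM⟩]

theorem sum_norm_sq_eq_sum_mul {ι κ E : Type*} [Fintype κ] [NormedAddCommGroup E]
    [InnerProductSpace ℝ E] {lam : κ → ℝ} (hlam : ∀ m, 0 < lam m) (b : OrthonormalBasis κ ℝ E)
    (f : ι → E) (s : Finset ι) :
    ∑ n ∈ s, ‖f n‖ ^ 2 = ∑ m, lam m * ∑ n ∈ s, ⟪b m, f n⟫ ^ 2 / lam m := by
  simp_rw [Finset.mul_sum, mul_div_cancel₀ _ (hlam _).ne', ← b.sum_sq_inner_right]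
  exact Finset.sum_comm

section Frame

variable {ι κ E : Type*} [Fintype ι] [Fintype κ] [NormedAddCommGroup E] [InnerProductSpace ℝ E]
  {S : E →ₗ[ℝ] E} {lam : κ → ℝ} {b : OrthonormalBasis κ ℝ E} {f : ι → E}

theorem inner_frameOperator_self (hf : ∀ x, ∑ n, ⟪x, f n⟫ • f n = S x) (x : E) :
    ⟪S x, x⟫ = ∑ n, ⟪x, f n⟫ ^ 2 := by
  rw [← hf, sum_inner]
  refine Finset.sum_congr rfl fun n _ => ?_
  rw [real_inner_smul_left, real_inner_comm, sq]

theorem sum_inner_sq_eq_eigenvalue (hSb : ∀ m, S (b m) = lam m • b m)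
    (hf : ∀ x, ∑ n, ⟪x, f n⟫ • f n = S x) (m : κ) : ∑ n, ⟪b m, f n⟫ ^ 2 = lam m := by
  rw [← inner_frameOperator_self hf, hSb, real_inner_smul_left, real_inner_self_eq_norm_sq,
    b.norm_eq_one]
  ring

theorem sum_inner_sq_div_eigenvalue_le_one (hlam : ∀ m, 0 < lam m)
    (hSb : ∀ m, S (b m) = lam m • b m) (hf : ∀ x, ∑ n, ⟪x, f n⟫ • f n = S x) (n : ι) :
    ∑ m, ⟪b m, f n⟫ ^ 2 / lam m ≤ 1 := by
  set g : E := ∑ m, (⟪b m, f n⟫ / lam m) • b m with hg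
  have hSg : S g = f n := by
    rw [hg, map_sum, ← b.sum_repr' (f n)]
    refine Finset.sum_congr rfl fun m _ => ?_
    rw [b.sum_repr' (f n), map_smul, hSb, smul_smul, div_mul_cancel₀ _ (hlam m).ne']
  have hgt : ⟪g, f n⟫ = ∑ m, ⟪b m, f n⟫ ^ 2 / lam m := by
    rw [hg, sum_inner]
    refine Finset.sum_congr rfl fun m _ => ?_
    rw [real_inner_smul_left]
    ring
  have hle : ⟪g, f n⟫ ^ 2 ≤ ⟪g, f n⟫ := by
    calc ⟪g, f n⟫ ^ 2 ≤ ∑ p, ⟪g, f p⟫ ^ 2 :=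
          Finset.single_le_sum (f := fun p => ⟪g, f p⟫ ^ 2) (fun _ _ => sq_nonneg _)
            (Finset.mem_univ n)
      _ = ⟪g, f n⟫ := by rw [← inner_frameOperator_self hf, hSg, real_inner_comm]
  rw [← hgt]
  nlinarith

theorem span_range_eq_top_of_frameOperator (hlam : ∀ m, 0 < lam m)
    (hSb : ∀ m, S (b m) = lam m • b m) (hf : ∀ x, ∑ n, ⟪x, f n⟫ • f n = S x) :
    Submodule.span ℝ (Set.range f) = ⊤ := by
  rw [eq_top_iff, ← b.toBasis.span_eq, Submodule.span_le]
  rintro _ ⟨m, rfl⟩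
  have hb : b.toBasis m = (lam m)⁻¹ • S (b m) := by
    rw [hSb, smul_smul, inv_mul_cancel₀ (hlam m).ne', one_smul, b.coe_toBasis]
  rw [hb, ← hf]
  exact Submodule.smul_mem _ _ (Submodule.sum_mem _ fun n _ =>
    Submodule.smul_mem _ _ (Submodule.subset_span ⟨n, rfl⟩))

end Frame

/-- The scaled eigenbasis, padded with zeros, has frame operator `S`. -/
theorem padded_eigenvalues_mem_frameNormSq {M N : ℕ} (hMN : M ≤ N) {E : Type*}
    [NormedAddCommGroup E] [InnerProductSpace ℝ E] {S : E →ₗ[ℝ] E} {lam : Fin M → ℝ}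
    (hlam : ∀ m, 0 ≤ lam m) {b : OrthonormalBasis (Fin M) ℝ E}
    (hSb : ∀ m, S (b m) = lam m • b m) :
    (fun n : Fin N => if h : (n : ℕ) < M then lam ⟨n, h⟩ else 0) ∈ frameNormSq (Fin N) S := by
  refine ⟨fun n => if h : (n : ℕ) < M then √(lam ⟨n, h⟩) • b ⟨n, h⟩ else 0, fun x => ?_,
    fun n => ?_⟩
  · have hSx : S x = ∑ m, (lam m * ⟪b m, x⟫) • b m := by
      conv_lhs => rw [← b.sum_repr' x]
      rw [map_sum]
      refine Finset.sum_congr rfl fun m _ => ?_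
      rw [map_smul, hSb, smul_smul, mul_comm]
    rw [hSx]
    refine (Fintype.sum_of_injective (Fin.castLE hMN) (Fin.castLE_injective hMN) _ _
      (fun n hn => ?_) fun m => ?_).symm
    · have : ¬ (n : ℕ) < M := fun h => hn ⟨⟨n, h⟩, rfl⟩
      simp [this]
    · simp only [Fin.val_castLE, Fin.is_lt, dite_true, Fin.eta, real_inner_smul_right, smul_smul]
      rw [real_inner_comm, mul_right_comm, Real.mul_self_sqrt (hlam m)]
  · dsimp only
    split_ifs with h
    · simp [norm_smul, Real.sq_sqrt (hlam _), b.norm_eq_one]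
    · simp

theorem sum_filter_lt_castLE {M N : ℕ} (hMN : M ≤ N) (lam : Fin M → ℝ) (k : ℕ) :
    ∑ n ∈ Finset.univ.filter (fun n : Fin N => (n : ℕ) < k),
        (if h : (n : ℕ) < M then lam ⟨n, h⟩ else 0)
      = ∑ m ∈ Finset.univ.filter (fun m : Fin M => (m : ℕ) < k), lam m := by
  rw [Finset.sum_filter, Finset.sum_filter]
  refine (Fintype.sum_of_injective (Fin.castLE hMN) (Fin.castLE_injective hMN) _ _
    (fun n hn => ?_) fun m => ?_).symm
  · have : ¬ (n : ℕ) < M := fun h => hn ⟨⟨n, h⟩, rfl⟩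
    simp [this]
  · simp

/-- the Schur–Horn theorem, frame-theoretic form.  The positive self-adjoint
operator `S` is given together with an orthonormal eigenbasis `b` with eigenvalues
`λ_1 ≥ … ≥ λ_M > 0` (counted with multiplicity). -/
theorem stmt_2 (M N : ℕ) (hM : 0 < M) (hMN : M ≤ N)
    (S : EuclideanSpace ℝ (Fin M) →ₗ[ℝ] EuclideanSpace ℝ (Fin M))
    (lam : Fin M → ℝ) (hlam_pos : ∀ m, 0 < lam m) (hlam_mono : Antitone lam)
    (b : OrthonormalBasis (Fin M) ℝ (EuclideanSpace ℝ (Fin M)))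
    (hSb : ∀ m, S (b m) = lam m • b m)
    (a : Fin N → ℝ) (ha_pos : ∀ n, 0 < a n) (ha_mono : Antitone a) :
    (∃ f : Fin N → EuclideanSpace ℝ (Fin M),
        Submodule.span ℝ (Set.range f) = ⊤ ∧
        (∀ x, ∑ n, ⟪x, f n⟫ • f n = S x) ∧
        ∀ n, ‖f n‖ = a n)
      ↔ ((∀ k : ℕ, k ≤ M →
            ∑ j ∈ Finset.univ.filter (fun j : Fin N => (j : ℕ) < k), a j ^ 2
              ≤ ∑ j ∈ Finset.univ.filter (fun j : Fin M => (j : ℕ) < k), lam j) ∧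
          ∑ n, a n ^ 2 = ∑ m, lam m) := by
  constructor
  · rintro ⟨f, -, hf, hfa⟩
    refine ⟨fun k hk => ?_, ?_⟩
    · simp_rw [← hfa]
      rw [sum_norm_sq_eq_sum_mul hlam_pos b]
      refine sum_mul_le_sum_filter_lt (fun m => (hlam_pos m).le) hlam_mono
        (fun m => Finset.sum_nonneg fun n _ => div_nonneg (sq_nonneg _) (hlam_pos m).le)
        (fun m => ?_) hk ?_
      · rw [← Finset.sum_div, div_le_one (hlam_pos m), ← sum_inner_sq_eq_eigenvalue hSb hf m]
        exact Finset.sum_le_sum_of_subset_of_nonneg (Finset.subset_univ _)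
          fun n _ _ => sq_nonneg _
      · rw [Finset.sum_comm]
        refine (Finset.sum_le_card_nsmul _ _ 1 fun n _ =>
          sum_inner_sq_div_eigenvalue_le_one hlam_pos hSb hf n).trans ?_
        rw [Fin.card_filter_val_lt, min_eq_right (hk.trans hMN), nsmul_one]
    · simp_rw [← hfa]
      rw [sum_norm_sq_eq_sum_mul hlam_pos b]
      refine Finset.sum_congr rfl fun m _ => ?_
      rw [← Finset.sum_div, sum_inner_sq_eq_eigenvalue hSb hf m, div_self (hlam_pos m).ne',
        mul_one]
  · rintro ⟨hle, htot⟩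
    have hIic : ∀ k : Fin N,
        Finset.Iic k = Finset.univ.filter (fun n : Fin N => (n : ℕ) < k + 1) := fun k => by
      ext n
      rw [Finset.mem_Iic, Finset.mem_filter, Fin.le_def]
      simp only [Finset.mem_univ, true_and]
      omega
    have hall : ∀ {m : ℕ} {k : ℕ}, m ≤ k →
        Finset.univ.filter (fun n : Fin m => (n : ℕ) < k) = Finset.univ := fun h =>
      Finset.filter_true_of_mem fun n _ => n.is_lt.trans_le h
    have hmem : (fun n => a n ^ 2) ∈ frameNormSq (Fin N) S := by
      refine (isTransferClosed_frameNormSq S).mem_of_sum_Iic_le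
        (fun i j hij => pow_le_pow_left₀ (ha_pos j).le (ha_mono hij) 2)
        (padded_eigenvalues_mem_frameNormSq hMN (fun m => (hlam_pos m).le) hSb) (fun k => ?_) ?_
      · rw [hIic, sum_filter_lt_castLE hMN]
        rcases le_total ((k : ℕ) + 1) M with hk | hk
        · exact hle _ hk
        · rw [hall hk, ← htot]
          exact Finset.sum_le_sum_of_subset_of_nonneg (Finset.subset_univ _)
            fun n _ _ => sq_nonneg _
      · have h := sum_filter_lt_castLE hMN lam N
        rw [hall le_rfl, hall hMN] at h
        rw [h, htot]
    obtain ⟨f, hf, hfa⟩ := hmem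
    exact ⟨f, span_range_eq_top_of_frameOperator hlam_pos hSb hf, hf, fun n =>
      (pow_left_inj₀ (norm_nonneg _) (ha_pos n).le two_ne_zero).1 (hfa n)⟩
end

section
/- For every N ≥ M ≥ 1 and every invertible, positive, self-adjoint operator S on ℝ^M, there exists an equal-norm frame {f_n}_{n=1}^N for ℝ^M (i.e., ‖f_n‖ = ‖f_{n'}‖ for all n, n') whose frame operator is S. In particular, for every N ≥ M there exists an equal-norm Parseval frame with N elements in ℝ^M. -/
open scoped RealInnerProductSpace

/-- Rotating two vectors of a finite family within their common plane, so that the first one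
acquires a prescribed intermediate squared norm, changes neither the frame operator nor the
remaining vectors. -/
theorem exists_rotation_frameOperator_eq {ι E : Type*} [Fintype ι]
    [NormedAddCommGroup E] [InnerProductSpace ℝ E] (f : ι → E) {i j : ι} (hij : i ≠ j) {c : ℝ}
    (hi : ‖f i‖ ^ 2 ≤ c) (hj : c ≤ ‖f j‖ ^ 2) :
    ∃ g : ι → E, (∀ x, ∑ n, ⟪x, g n⟫ • g n = ∑ n, ⟪x, f n⟫ • f n) ∧
      ∑ n, ‖g n‖ ^ 2 = ∑ n, ‖f n‖ ^ 2 ∧ ‖g i‖ ^ 2 = c ∧ ∀ n, n ≠ i → n ≠ j → g n = f n := by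
  classical
  obtain ⟨θ, -, hθ⟩ : ∃ θ ∈ Set.Icc 0 (Real.pi / 2),
      ‖Real.cos θ • f i + Real.sin θ • f j‖ ^ 2 = c := by
    have hcont : ContinuousOn (fun θ : ℝ => ‖Real.cos θ • f i + Real.sin θ • f j‖ ^ 2)
        (Set.Icc 0 (Real.pi / 2)) := by fun_prop
    exact intermediate_value_Icc (by positivity) hcont ⟨by simpa using hi, by simpa using hj⟩
  have hcs := Real.sin_sq_add_cos_sq θ
  set s := Real.sin θ
  set t := Real.cos θ
  let g := Function.update (Function.update f i (t • f i + s • f j)) j (t • f j - s • f i)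
  have hgi : g i = t • f i + s • f j := by simp [g, hij]
  have hgj : g j = t • f j - s • f i := by simp [g]
  have hg : ∀ n, n ≠ i → n ≠ j → g n = f n := fun n h₁ h₂ => by simp [g, h₁, h₂]
  refine ⟨g, fun x => ?_, ?_, by rw [hgi, hθ], hg⟩
  · rw [← sub_eq_zero, ← Finset.sum_sub_distrib,
      Fintype.sum_eq_add i j hij fun n hn => by rw [hg n hn.1 hn.2, sub_self], hgi, hgj]
    simp only [inner_add_right, inner_sub_right, real_inner_smul_right]
    linear_combination (norm := module) hcs • (⟪x, f i⟫ • f i + ⟪x, f j⟫ • f j)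
  · rw [← sub_eq_zero, ← Finset.sum_sub_distrib,
      Fintype.sum_eq_add i j hij fun n hn => by rw [hg n hn.1 hn.2, sub_self], hgi, hgj,
      norm_add_sq_real, norm_sub_sq_real]
    simp only [norm_smul, real_inner_smul_left, real_inner_smul_right, mul_pow, Real.norm_eq_abs,
      sq_abs, real_inner_comm (f i) (f j)]
    linear_combination (‖f i‖ ^ 2 + ‖f j‖ ^ 2) * hcs

/-- Every finite family of vectors can be replaced by one with the same frame operator whose
vectors all have the same norm. -/
theorem exists_equalNorm_frameOperator_eq {ι E : Type*} [Fintype ι]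
    [NormedAddCommGroup E] [InnerProductSpace ℝ E] (f : ι → E) (c : ℝ)
    (hc : ∑ n, ‖f n‖ ^ 2 = ∑ _n : ι, c) :
    ∃ g : ι → E, (∀ x, ∑ n, ⟪x, g n⟫ • g n = ∑ n, ⟪x, f n⟫ • f n) ∧ ∀ n, ‖g n‖ ^ 2 = c := by
  classical
  induction hk : (Finset.univ.filter fun n => ‖f n‖ ^ 2 ≠ c).card using Nat.strong_induction_on
    generalizing f with
  | _ k ih =>
  by_cases hall : ∀ n, ‖f n‖ ^ 2 = c
  · exact ⟨f, fun _ => rfl, hall⟩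
  push Not at hall
  obtain ⟨m, hm⟩ := hall
  obtain ⟨i, hi⟩ : ∃ i, ‖f i‖ ^ 2 < c := by
    by_contra! h
    exact hm ((Finset.sum_eq_sum_iff_of_le fun n _ => h n).1 hc.symm m (Finset.mem_univ m)).symm
  obtain ⟨j, hj⟩ : ∃ j, c < ‖f j‖ ^ 2 := by
    by_contra! h
    exact hm ((Finset.sum_eq_sum_iff_of_le fun n _ => h n).1 hc m (Finset.mem_univ m))
  have hij : i ≠ j := by
    rintro rfl
    exact lt_asymm hi hj
  obtain ⟨g, hgf, hgs, hgi, hg⟩ := exists_rotation_frameOperator_eq f hij hi.le hj.le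
  obtain ⟨g', hg', hn⟩ := ih _ (by
    rw [← hk]
    refine Finset.card_lt_card (Finset.ssubset_iff_of_subset ?_ |>.2 ⟨i, ?_, ?_⟩)
    · intro n hn
      simp only [Finset.mem_filter, Finset.mem_univ, true_and] at hn ⊢
      by_cases h₁ : n = i
      · exact absurd (h₁ ▸ hgi) hn
      by_cases h₂ : n = j
      · exact h₂ ▸ hj.ne'
      rwa [← hg n h₁ h₂]
    · simpa using hi.ne
    · simpa using hgi) g (hgs.trans hc) rfl
  exact ⟨g', fun x => (hg' x).trans (hgf x), hn⟩

/-- A positive symmetric operator on `ℝ^M` is the frame operator of some family of `N ≥ M`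
vectors. -/
theorem exists_frameOperator_eq {M N : ℕ} (hMN : M ≤ N)
    {S : EuclideanSpace ℝ (Fin M) →ₗ[ℝ] EuclideanSpace ℝ (Fin M)} (hsym : S.IsSymmetric)
    (hpos : ∀ x, 0 ≤ ⟪S x, x⟫) :
    ∃ f : Fin N → EuclideanSpace ℝ (Fin M), ∀ x, ∑ n, ⟪x, f n⟫ • f n = S x := by
  obtain ⟨k, rfl⟩ := Nat.exists_eq_add_of_le hMN
  have hdim : Module.finrank ℝ (EuclideanSpace ℝ (Fin M)) = M := by simp
  let b := hsym.eigenvectorBasis hdim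
  let μ := hsym.eigenvalues hdim
  have hb : ∀ i, S (b i) = μ i • b i := hsym.apply_eigenvectorBasis hdim
  have hμ : ∀ i, 0 ≤ μ i := fun i => by
    simpa [hb, real_inner_smul_left] using hpos (b i)
  refine ⟨Fin.append (fun i => √(μ i) • b i) 0, fun x => ?_⟩
  rw [Fin.sum_univ_add, ← b.sum_repr' (S x)]
  simp only [Fin.append_left, Fin.append_right, Pi.zero_apply, smul_zero, Finset.sum_const_zero,
    add_zero]
  refine Finset.sum_congr rfl fun i _ => ?_
  rw [← hsym, hb, real_inner_smul_left, real_inner_smul_right, smul_smul, real_inner_comm,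
    mul_right_comm, Real.mul_self_sqrt (hμ i)]

/-- A positive symmetric surjective operator on `ℝ^M` is the frame operator of an equal-norm
frame of `N` vectors, for every `N ≥ M`. -/
theorem exists_equalNorm_frame {M N : ℕ} (hMN : M ≤ N)
    {S : EuclideanSpace ℝ (Fin M) →ₗ[ℝ] EuclideanSpace ℝ (Fin M)} (hsym : S.IsSymmetric)
    (hpos : ∀ x, 0 ≤ ⟪S x, x⟫) (hsurj : Function.Surjective S) :
    ∃ f : Fin N → EuclideanSpace ℝ (Fin M), Submodule.span ℝ (Set.range f) = ⊤ ∧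
      (∀ x, ∑ n, ⟪x, f n⟫ • f n = S x) ∧ ∀ n n', ‖f n‖ = ‖f n'‖ := by
  obtain ⟨f, hf⟩ := exists_frameOperator_eq hMN hsym hpos
  obtain ⟨g, hg, hn⟩ := exists_equalNorm_frameOperator_eq f ((∑ n, ‖f n‖ ^ 2) / N) (by
    rcases Nat.eq_zero_or_pos N with rfl | hN
    · simp
    · simp [field])
  refine ⟨g, Submodule.eq_top_iff'.2 fun y => ?_, fun x => (hg x).trans (hf x), fun n n' => ?_⟩
  · obtain ⟨x, rfl⟩ := hsurj y
    rw [← hf, ← hg]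
    exact Submodule.sum_mem _ fun n _ => Submodule.smul_mem _ _ (Submodule.subset_span ⟨n, rfl⟩)
  · exact (sq_eq_sq₀ (norm_nonneg _) (norm_nonneg _)).1 ((hn n).trans (hn n').symm)

/-- for every `N ≥ M ≥ 1` and every invertible positive self-adjoint operator `S`
on `ℝ^M` there is an equal-norm frame of `N` vectors with frame operator `S`; in particular
there is an equal-norm Parseval frame with `N` elements. -/
theorem stmt_3 (M N : ℕ) (hM : 1 ≤ M) (hMN : M ≤ N)
    (S : EuclideanSpace ℝ (Fin M) →ₗ[ℝ] EuclideanSpace ℝ (Fin M))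
    (hsym : ∀ x y : EuclideanSpace ℝ (Fin M), ⟪S x, y⟫ = ⟪x, S y⟫)
    (hpos : ∀ x : EuclideanSpace ℝ (Fin M), 0 ≤ ⟪S x, x⟫)
    (hinv : Function.Bijective S) :
    (∃ f : Fin N → EuclideanSpace ℝ (Fin M),
        Submodule.span ℝ (Set.range f) = ⊤ ∧
        (∀ x, ∑ n, ⟪x, f n⟫ • f n = S x) ∧
        ∀ n n', ‖f n‖ = ‖f n'‖) ∧
    (∃ g : Fin N → EuclideanSpace ℝ (Fin M),
        Submodule.span ℝ (Set.range g) = ⊤ ∧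
        (∀ x, ∑ n, ⟪x, g n⟫ • g n = x) ∧
        ∀ n n', ‖g n‖ = ‖g n'‖) := by
  exact ⟨exists_equalNorm_frame hMN hsym hpos hinv.surjective,
    exists_equalNorm_frame (S := LinearMap.id) hMN (fun _ _ => rfl)
      (fun x => real_inner_self_nonneg) Function.surjective_id⟩
end

section
/- Let N ≥ M > 0 be integers and let λ_1,…,λ_M be real numbers with λ_m ≥ 2 for all m and Σ_{m=1}^M λ_m = N. Then there exists a unit norm frame {f_n}_{n=1}^N for ℝ^M whose frame operator is diagonal with respect to the standard basis with diagonal entries λ_1,…,λ_M (in some order), and whose total number of nonzero standard coordinates Σ_{n=1}^N #{m : ⟨f_n, e_m⟩ ≠ 0} equals exactly N + 2(M − μ(λ_1,…,λ_M)); by the corresponding lower bound, such a frame is optimally sparse among all unit norm frames of N vectors in ℝ^M with these eigenvalues. -/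
open scoped RealInnerProductSpace

/-- The maximal block number `μ(λ_1,…,λ_M)`: the maximum over all permutations `σ` of
`{1,…,M}` of the number of indices `s` for which the partial sum `Σ_{m=1}^s λ_{σ(m)}`
is an integer. -/
noncomputable def maxBlockNumber (M : ℕ) (lam : Fin M → ℝ) : ℕ :=
  Finset.univ.sup fun σ : Equiv.Perm (Fin M) =>
    {s : Fin M | ∃ z : ℤ,
      (∑ m ∈ Finset.univ.filter (fun m : Fin M => m ≤ s), lam (σ m)) = (z : ℝ)}.ncard

/-- The `(k, n)` entry of the spectral tetris matrix whose `k`-th row has leading `2 × 2` block in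
columns `F k` and `F k + 1`, where `r k` is the weight of that block carried by row `k - 1`. -/
noncomputable def spectralTetris (F : ℕ → ℕ) (r : ℕ → ℝ) (k n : ℕ) : ℝ :=
  if n = F k then √(1 - r k / 2)
  else if n = F k + 1 then -√(1 - r k / 2)
  else if F k + 2 ≤ n ∧ n < F (k + 1) then 1
  else if n = F (k + 1) ∨ n = F (k + 1) + 1 then √(r (k + 1) / 2)
  else 0

lemma add_two_le_of_lt {F : ℕ → ℕ} (hF : ∀ m, F m + 2 ≤ F (m + 1)) {i j : ℕ} (h : i < j) :
    F i + 2 ≤ F j := by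
  induction j, h using Nat.le_induction with
  | base => exact hF i
  | succ j _ ih => have := hF j; omega

lemma spectralTetris_left {F : ℕ → ℕ} (hF : ∀ m, F m + 2 ≤ F (m + 1)) (r : ℕ → ℝ) (k m : ℕ) :
    spectralTetris F r k (F m) =
      if k = m then √(1 - r m / 2) else if k + 1 = m then √(r m / 2) else 0 := by
  have hk := hF k
  rcases lt_trichotomy k m with h | rfl | h
  · have h1 := add_two_le_of_lt hF h
    rcases (show k + 1 ≤ m from h).eq_or_lt with rfl | h'
    · unfold spectralTetris
      rw [if_neg (by omega), if_neg (by omega), if_neg (by omega), if_pos (by omega),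
        if_neg (by omega), if_pos rfl]
    · have h2 := add_two_le_of_lt hF h'
      unfold spectralTetris
      rw [if_neg (by omega), if_neg (by omega), if_neg (by omega), if_neg (by omega),
        if_neg (by omega), if_neg (by omega)]
  · simp [spectralTetris]
  · have h1 := add_two_le_of_lt hF h
    unfold spectralTetris
    rw [if_neg (by omega), if_neg (by omega), if_neg (by omega), if_neg (by omega),
      if_neg (by omega), if_neg (by omega)]

lemma spectralTetris_right {F : ℕ → ℕ} (hF : ∀ m, F m + 2 ≤ F (m + 1)) (r : ℕ → ℝ) (k m : ℕ) :
    spectralTetris F r k (F m + 1) =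
      if k = m then -√(1 - r m / 2) else if k + 1 = m then √(r m / 2) else 0 := by
  have hk := hF k
  rcases lt_trichotomy k m with h | rfl | h
  · have h1 := add_two_le_of_lt hF h
    rcases (show k + 1 ≤ m from h).eq_or_lt with rfl | h'
    · unfold spectralTetris
      rw [if_neg (by omega), if_neg (by omega), if_neg (by omega), if_pos (by omega),
        if_neg (by omega), if_pos rfl]
    · have h2 := add_two_le_of_lt hF h'
      unfold spectralTetris
      rw [if_neg (by omega), if_neg (by omega), if_neg (by omega), if_neg (by omega),
        if_neg (by omega), if_neg (by omega)]
  · simp [spectralTetris]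
  · have h1 := add_two_le_of_lt hF h
    unfold spectralTetris
    rw [if_neg (by omega), if_neg (by omega), if_neg (by omega), if_neg (by omega),
      if_neg (by omega), if_neg (by omega)]

lemma spectralTetris_mid {F : ℕ → ℕ} (hF : ∀ m, F m + 2 ≤ F (m + 1)) (r : ℕ → ℝ) (k : ℕ)
    {m n : ℕ} (hn : F m + 2 ≤ n) (hn' : n < F (m + 1)) :
    spectralTetris F r k n = if k = m then 1 else 0 := by
  have hk := hF k
  rcases lt_trichotomy k m with h | rfl | h
  · have h2 : F (k + 1) ≤ F m := by
      rcases (show k + 1 ≤ m from h).eq_or_lt with rfl | h'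
      · rfl
      · have := add_two_le_of_lt hF h'
        omega
    unfold spectralTetris
    rw [if_neg (by omega), if_neg (by omega), if_neg (by omega), if_neg (by omega),
      if_neg (by omega)]
  · unfold spectralTetris
    rw [if_neg (by omega), if_neg (by omega), if_pos ⟨hn, hn'⟩, if_pos rfl]
  · have h2 : F (m + 1) ≤ F k := by
      rcases (show m + 1 ≤ k from h).eq_or_lt with rfl | h'
      · rfl
      · have := add_two_le_of_lt hF h'
        omega
    unfold spectralTetris
    rw [if_neg (by omega), if_neg (by omega), if_neg (by omega), if_neg (by omega),
      if_neg (by omega)]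

lemma sum_range_eq_sum_blocks {β : Type*} [AddCommMonoid β] {F : ℕ → ℕ} (h0 : F 0 = 0)
    (hF : ∀ m, F m + 2 ≤ F (m + 1)) (h : ℕ → β) (M : ℕ) :
    ∑ n ∈ Finset.range (F M), h n =
      ∑ m ∈ Finset.range M,
        (h (F m) + h (F m + 1) + ∑ n ∈ Finset.Ico (F m + 2) (F (m + 1)), h n) := by
  induction M with
  | zero => simp [h0]
  | succ M ih =>
    have h1 := hF M
    rw [Finset.sum_range_succ, ← ih,
      ← Finset.sum_range_add_sum_Ico h (show F M ≤ F (M + 1) by omega),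
      Finset.sum_eq_sum_Ico_succ_bot (show F M < F (M + 1) by omega),
      Finset.sum_eq_sum_Ico_succ_bot (show F M + 1 < F (M + 1) by omega)]
    simp only [add_assoc, Nat.reduceAdd]

lemma sum_range_ite_pair {β : Type*} [AddCommMonoid β] (h : ℝ → β) (h0 : h 0 = 0) {M m : ℕ}
    (hm : m < M) (a b : ℝ) (hb : m = 0 → b = 0) :
    ∑ k ∈ Finset.range M, h (if k = m then a else if k + 1 = m then b else 0) = h a + h b := by
  have key : ∀ k, h (if k = m then a else if k + 1 = m then b else 0) =
      (if k = m then h a else 0) + (if k + 1 = m then h b else 0) := by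
    intro k
    split_ifs <;> first | omega | simp [h0]
  simp only [key, Finset.sum_add_distrib]
  congr 1
  · simp [hm]
  · rcases m with _ | m
    · simp [hb rfl, h0]
    · simp only [add_left_inj, Finset.sum_ite_eq', Finset.mem_range]
      rw [if_pos (by omega)]

lemma exists_block {F : ℕ → ℕ} (h0 : F 0 = 0) {M n : ℕ} (hn : n < F M) :
    ∃ m < M, F m ≤ n ∧ n < F (m + 1) := by
  induction M with
  | zero => omega
  | succ M ih =>
    by_cases h : n < F M
    · obtain ⟨m, hm, h'⟩ := ih h
      exact ⟨m, by omega, h'⟩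
    · exact ⟨M, by omega, by omega, hn⟩

section

variable {F : ℕ → ℕ} {r : ℕ → ℝ}

lemma spectralTetris_sum_sq (hF0 : F 0 = 0) (hF : ∀ m, F m + 2 ≤ F (m + 1)) (hr0 : r 0 = 0)
    (hr : ∀ m, 0 ≤ r m) (hr1 : ∀ m, r m < 1) {M n : ℕ} (hn : n < F M) :
    ∑ k ∈ Finset.range M, spectralTetris F r k n ^ 2 = 1 := by
  obtain ⟨m, hm, h1, h2⟩ := exists_block hF0 hn
  have hs : m = 0 → √(r m / 2) = 0 := by rintro rfl; simp [hr0]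
  have e1 : √(r m / 2) ^ 2 = r m / 2 := Real.sq_sqrt (by linarith [hr m])
  have e2 : √(1 - r m / 2) ^ 2 = 1 - r m / 2 := Real.sq_sqrt (by linarith [hr1 m])
  rcases h1.eq_or_lt with rfl | h1
  · simp only [spectralTetris_left hF]
    rw [sum_range_ite_pair (· ^ 2) (by simp) hm _ _ hs, e1, e2]
    ring
  rcases (show F m + 1 ≤ n from h1).eq_or_lt with rfl | h1
  · simp only [spectralTetris_right hF]
    rw [sum_range_ite_pair (· ^ 2) (by simp) hm _ _ hs, neg_sq, e1, e2]
    ring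
  · simp only [spectralTetris_mid hF r _ h1 h2]
    simp [hm]

lemma spectralTetris_sum_mul (hF0 : F 0 = 0) (hF : ∀ m, F m + 2 ≤ F (m + 1))
    (hr : ∀ m, 0 ≤ r m) (hr1 : ∀ m, r m < 1) {M : ℕ} (hM : r M = 0) {k l : ℕ} (hk : k < M) :
    ∑ n ∈ Finset.range (F M), spectralTetris F r k n * spectralTetris F r l n =
      if k = l then (F (k + 1) + r (k + 1)) - (F k + r k) else 0 := by
  rw [sum_range_eq_sum_blocks hF0 hF]
  have key : ∀ m,
      spectralTetris F r k (F m) * spectralTetris F r l (F m) +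
        spectralTetris F r k (F m + 1) * spectralTetris F r l (F m + 1) +
        ∑ n ∈ Finset.Ico (F m + 2) (F (m + 1)), spectralTetris F r k n * spectralTetris F r l n =
      (if k = m then (if k = l then (F (m + 1) : ℝ) - F m - r m else 0) else 0) +
      (if k + 1 = m then (if k = l then r m else 0) else 0) := by
    intro m
    have e1 : √(r m / 2) * √(r m / 2) = r m / 2 := Real.mul_self_sqrt (by linarith [hr m])
    have e2 : √(1 - r m / 2) * √(1 - r m / 2) = 1 - r m / 2 :=
      Real.mul_self_sqrt (by linarith [hr1 m])
    have e3 : ∑ n ∈ Finset.Ico (F m + 2) (F (m + 1)),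
        spectralTetris F r k n * spectralTetris F r l n =
        if k = m ∧ l = m then (F (m + 1) : ℝ) - F m - 2 else 0 := by
      rw [Finset.sum_congr rfl (g := fun _ => if k = m ∧ l = m then (1 : ℝ) else 0)]
      · have := hF m
        split_ifs
        · rw [Finset.sum_const, Nat.card_Ico, nsmul_eq_mul, Nat.cast_sub this]
          push_cast; ring
        · simp
      · intro n hn
        rw [Finset.mem_Ico] at hn
        rw [spectralTetris_mid hF r k hn.1 hn.2, spectralTetris_mid hF r l hn.1 hn.2]
        split_ifs <;> simp_all
    rw [e3]
    simp only [spectralTetris_left hF, spectralTetris_right hF]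
    split_ifs <;> first | omega | nlinarith
  simp only [key, Finset.sum_add_distrib, Finset.sum_ite_eq, Finset.mem_range, if_pos hk]
  by_cases hkl : k = l
  · simp only [if_pos hkl]
    split_ifs with h
    · ring
    · rw [show k + 1 = M by omega, hM]; ring
  · simp [hkl]

lemma spectralTetris_sum_support (hF0 : F 0 = 0) (hF : ∀ m, F m + 2 ≤ F (m + 1)) (hr0 : r 0 = 0)
    (hr : ∀ m, 0 ≤ r m) (hr1 : ∀ m, r m < 1) (M : ℕ) :
    ∑ n ∈ Finset.range (F M), ∑ k ∈ Finset.range M, (if spectralTetris F r k n = 0 then 0 else 1) =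
      F M + 2 * ∑ m ∈ Finset.range M, (if r m = 0 then 0 else 1) := by
  rw [sum_range_eq_sum_blocks hF0 hF, Finset.mul_sum]
  have hFM : F M = ∑ m ∈ Finset.range M, (F (m + 1) - F m) := by
    have := sum_range_eq_sum_blocks hF0 hF (fun _ => 1) M
    simp only [Finset.sum_const, Finset.card_range, smul_eq_mul, mul_one, Nat.card_Ico] at this
    rw [this]
    refine Finset.sum_congr rfl fun m _ => ?_
    have := hF m
    omega
  conv_rhs => rw [hFM]
  rw [← Finset.sum_add_distrib]
  refine Finset.sum_congr rfl fun m hm => ?_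
  rw [Finset.mem_range] at hm
  have hs : m = 0 → √(r m / 2) = 0 := by rintro rfl; simp [hr0]
  have e1 : √(r m / 2) = 0 ↔ r m = 0 := by
    rw [Real.sqrt_eq_zero (by linarith [hr m])]
    constructor <;> intro h <;> linarith
  have e2 : √(1 - r m / 2) ≠ 0 := (Real.sqrt_pos.2 (by linarith [hr1 m])).ne'
  have e3 : ∑ n ∈ Finset.Ico (F m + 2) (F (m + 1)),
      ∑ k ∈ Finset.range M, (if spectralTetris F r k n = 0 then 0 else 1) =
      F (m + 1) - (F m + 2) := by
    rw [Finset.sum_congr rfl (g := fun _ => 1)]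
    · simp
    · intro n hn
      rw [Finset.mem_Ico] at hn
      simp only [spectralTetris_mid hF r _ hn.1 hn.2]
      simp [hm]
  rw [e3]
  simp only [spectralTetris_left hF, spectralTetris_right hF]
  rw [sum_range_ite_pair (fun x => if x = 0 then 0 else 1) (by simp) hm _ _ hs,
    sum_range_ite_pair (fun x => if x = 0 then 0 else 1) (by simp) hm _ _ hs]
  simp only [neg_eq_zero, e1, e2, if_false]
  have := hF m
  omega

end

lemma span_range_eq_top_of_frameOperator_s7 {ι κ : Type*} [Fintype ι] [Fintype κ] [DecidableEq κ]
    (f : ι → EuclideanSpace ℝ κ) (c : κ → ℝ) (hc : ∀ m, c m ≠ 0)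
    (h : ∀ m, ∑ n, ⟪EuclideanSpace.single m (1 : ℝ), f n⟫ • f n
      = c m • EuclideanSpace.single m (1 : ℝ)) :
    Submodule.span ℝ (Set.range f) = ⊤ := by
  rw [eq_top_iff, ← (EuclideanSpace.basisFun κ ℝ).toBasis.span_eq, Submodule.span_le]
  rintro _ ⟨m, rfl⟩
  have hm : c m • EuclideanSpace.single m (1 : ℝ) ∈ Submodule.span ℝ (Set.range f) := by
    rw [← h]
    exact Submodule.sum_mem _ fun n _ =>
      Submodule.smul_mem _ _ (Submodule.subset_span ⟨n, rfl⟩)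
  simpa using (Submodule.smul_mem_iff _ (hc m)).1 hm

/-- existence of an optimally sparse unit norm frame whose frame operator is
diagonal with respect to the standard basis with diagonal entries `λ_1,…,λ_M` in some order,
attaining the sparsity bound `N + 2(M − μ(λ_1,…,λ_M))` exactly. -/
theorem stmt_7 (M N : ℕ) (hM : 0 < M) (hMN : M ≤ N)
    (lam : Fin M → ℝ) (hlam : ∀ m, 2 ≤ lam m) (hsum : ∑ m, lam m = N) :
    ∃ (f : Fin N → EuclideanSpace ℝ (Fin M)) (σ : Equiv.Perm (Fin M)),
      Submodule.span ℝ (Set.range f) = ⊤ ∧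
      (∀ n, ‖f n‖ = 1) ∧
      (∀ m : Fin M, ∑ n, ⟪EuclideanSpace.single m (1 : ℝ), f n⟫ • f n
          = lam (σ m) • EuclideanSpace.single m (1 : ℝ)) ∧
      (∑ n, {m : Fin M | f n m ≠ 0}.ncard)
        = N + 2 * (M - maxBlockNumber M lam) := by
  obtain ⟨σ, -, hσ⟩ := Finset.exists_mem_eq_sup (Finset.univ : Finset (Equiv.Perm (Fin M)))
    Finset.univ_nonempty fun σ : Equiv.Perm (Fin M) =>
      {s : Fin M | ∃ z : ℤ,
        (∑ m ∈ Finset.univ.filter (fun m : Fin M => m ≤ s), lam (σ m)) = (z : ℝ)}.ncard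
  let a : ℕ → ℝ := fun i => if h : i < M then lam (σ ⟨i, h⟩) else 2
  have ha : ∀ i, 2 ≤ a i := by
    intro i
    by_cases h : i < M
    · simpa [a, h] using hlam _
    · simp [a, h]
  have ha' : ∀ m : Fin M, a m = lam (σ m) := fun m => by simp [a]
  let S : ℕ → ℝ := fun t => ∑ i ∈ Finset.range t, a i
  have hS : ∀ t, S (t + 1) = S t + a t := fun t => Finset.sum_range_succ _ _
  have hS0 : S 0 = 0 := by simp [S]
  have hSnn : ∀ t, 0 ≤ S t := fun t => Finset.sum_nonneg fun i _ => by linarith [ha i]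
  have hSM : S M = N := by
    simp only [S]
    rw [Finset.sum_range, ← hsum, ← Equiv.sum_comp σ lam]
    exact Finset.sum_congr rfl fun m _ => ha' m
  let F : ℕ → ℕ := fun t => ⌊S t⌋₊
  let r : ℕ → ℝ := fun t => S t - F t
  have hF0 : F 0 = 0 := by simp [F, hS0]
  have hFM : F M = N := by simp [F, hSM]
  have hr0 : r 0 = 0 := by simp [r, hS0, hF0]
  have hrM : r M = 0 := by simp [r, hSM, hFM]
  have hr : ∀ m, 0 ≤ r m := fun m => sub_nonneg.2 (Nat.floor_le (hSnn m))
  have hr1 : ∀ m, r m < 1 := fun m => by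
    have := Nat.lt_floor_add_one (S m)
    simp only [r, F]
    linarith
  have hF : ∀ m, F m + 2 ≤ F (m + 1) := fun m => by
    refine Nat.le_floor ?_
    push_cast
    linarith [hS m, ha m, Nat.floor_le (hSnn m)]
  have hrz : ∀ t, r t = 0 ↔ ∃ z : ℤ, S t = z := by
    intro t
    constructor
    · intro h
      exact ⟨F t, by push_cast; linarith [show r t = S t - F t from rfl]⟩
    · rintro ⟨z, hz⟩
      have h1 : (F t : ℝ) + r t = z := by rw [← hz]; simp [r]
      have h2 : r t = ((z - F t : ℤ) : ℝ) := by push_cast; linarith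
      have h3 := hr t
      have h4 := hr1 t
      rw [h2] at h3 h4 ⊢
      have h5 : (0 : ℤ) ≤ z - F t := by exact_mod_cast h3
      have h6 : z - F t < (1 : ℤ) := by exact_mod_cast h4
      rw [show z - F t = 0 by omega]
      simp
  have hmu : maxBlockNumber M lam = ∑ m ∈ Finset.range M, (if r m = 0 then 1 else 0) := by
    have hshift : ∑ m ∈ Finset.range M, (if r m = 0 then 1 else 0) =
        ∑ m ∈ Finset.range M, (if r (m + 1) = 0 then 1 else 0) := by
      have h1 := Finset.sum_range_succ (fun m => if r m = 0 then 1 else 0) M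
      have h2 := Finset.sum_range_succ' (fun m => if r m = 0 then 1 else 0) M
      simp only [hr0, hrM, if_true] at h1 h2
      omega
    classical
    rw [hshift, Finset.sum_range, maxBlockNumber, hσ, Set.ncard_eq_toFinset_card',
      Finset.card_eq_sum_ones, ← Finset.sum_filter]
    refine Finset.sum_congr ?_ fun _ _ => rfl
    ext s
    have : ∑ m ∈ Finset.univ.filter (fun m : Fin M => m ≤ s), lam (σ m) = S (s + 1) := by
      simp only [← ha', S]
      refine Finset.sum_bij (fun m _ => (m : ℕ)) ?_ ?_ ?_ ?_
      · intro m hm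
        simpa [Nat.lt_succ_iff] using hm
      · intro m _ m' _ h
        exact Fin.ext h
      · intro i hi
        rw [Finset.mem_range] at hi
        exact ⟨⟨i, by omega⟩, Finset.mem_filter.2 ⟨Finset.mem_univ _, 
          Fin.le_def.2 (Nat.lt_succ_iff.1 hi)⟩, rfl⟩
      · intros; rfl
    rw [Finset.mem_filter, Set.mem_toFinset, Set.mem_ofPred_eq, this, hrz]
    simp
  let f : Fin N → EuclideanSpace ℝ (Fin M) := fun n =>
    WithLp.toLp 2 fun k : Fin M => spectralTetris F r k n
  have hop : ∀ m : Fin M, ∑ n, ⟪EuclideanSpace.single m (1 : ℝ), f n⟫ • f n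
      = lam (σ m) • EuclideanSpace.single m (1 : ℝ) := by
    intro m
    ext l
    have h := spectralTetris_sum_mul hF0 hF hr hr1 hrM (k := m) (l := l) m.2
    rw [hFM, Finset.sum_range] at h
    simp only [EuclideanSpace.inner_single_left, WithLp.ofLp_sum, Finset.sum_apply,
      PiLp.smul_apply, smul_eq_mul, map_one, one_mul, PiLp.single_apply, f]
    rw [h]
    simp only [Fin.ext_iff, eq_comm (a := (l : ℕ)), ← ha']
    have := hS m
    split_ifs
    · simp only [r]; linarith
    · simp
  refine ⟨f, σ, span_range_eq_top_of_frameOperator_s7 f (fun m => lam (σ m))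
    (fun m => by linarith [hlam (σ m)]) hop, ?_, hop, ?_⟩
  · intro n
    rw [EuclideanSpace.norm_eq, Real.sqrt_eq_one]
    have h := spectralTetris_sum_sq hF0 hF hr0 hr hr1 (M := M) (n := n) (hFM ▸ n.2)
    rw [Finset.sum_range] at h
    simpa [f] using h
  · have h := spectralTetris_sum_support hF0 hF hr0 hr hr1 M
    rw [hFM, Finset.sum_range] at h
    have hcompl : ∑ m ∈ Finset.range M, (if r m = 0 then 0 else 1) = M - maxBlockNumber M lam := by
      rw [hmu, eq_tsub_iff_add_eq_of_le, ← Finset.sum_add_distrib]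
      · rw [Finset.sum_congr rfl (g := fun _ => 1) (fun m _ => by split_ifs <;> rfl)]
        simp
      · calc _ ≤ ∑ m ∈ Finset.range M, 1 := Finset.sum_le_sum fun m _ => by split_ifs <;> simp
          _ = M := by simp
    rw [← hcompl, ← h]
    refine Finset.sum_congr rfl fun n _ => ?_
    rw [Finset.sum_range, Set.ncard_eq_toFinset_card', Finset.card_eq_sum_ones]
    simp only [f, Set.toFinset_ofPred, Finset.sum_filter, ne_eq, ite_not]
end

section
/- For any positive integers M, N with N ≥ 2M, there exists a unit norm tight frame {f_n}_{n=1}^N for ℝ^M with the property that ⟨f_n, f_{n'}⟩ = 0 whenever |n' − n| ≥ ⌊N/M⌋ + 3. -/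
open scoped RealInnerProductSpace

/-- The entry in column `n` and row `i` of the spectral tetris matrix: row `i` starts at column
`k i`, ends at column `k (i + 1) + 1`, and overlaps row `i + 1` in a `2 × 2` block with entries
`b (i + 1), b (i + 1)` and `a (i + 1), -a (i + 1)`. -/
def tetrisEntry (k : ℕ → ℕ) (a b : ℕ → ℝ) (n i : ℕ) : ℝ :=
  if n < k i then 0 else if n = k i then a i else if n = k i + 1 then -a i
  else if n < k (i + 1) then 1 else if n ≤ k (i + 1) + 1 then b (i + 1) else 0

section TetrisEntry

variable {k : ℕ → ℕ} {a b : ℕ → ℝ}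

theorem tetrisEntry_of_lt {n i : ℕ} (h : n < k i) : tetrisEntry k a b n i = 0 :=
  if_pos h

theorem tetrisEntry_of_gt (hk : ∀ i, k i + 2 ≤ k (i + 1)) {n i : ℕ} (h : k (i + 1) + 1 < n) :
    tetrisEntry k a b n i = 0 := by
  have := hk i
  unfold tetrisEntry
  split_ifs <;> first | rfl | omega

theorem tetrisEntry_sq (hk : ∀ i, k i + 2 ≤ k (i + 1)) (hab : ∀ i, a i ^ 2 + b i ^ 2 = 1)
    (n i : ℕ) :
    tetrisEntry k a b n i ^ 2 =
      (((if n < k (i + 1) then 1 else 0) + (if n = k (i + 1) then b (i + 1) ^ 2 else 0) +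
        (if n = k (i + 1) + 1 then b (i + 1) ^ 2 else 0)) -
      ((if n < k i then 1 else 0) + (if n = k i then b i ^ 2 else 0) +
        (if n = k i + 1 then b i ^ 2 else 0))) := by
  have := hk i
  have := hab i
  unfold tetrisEntry
  split_ifs <;> first | omega | linarith

theorem tetrisEntry_mul_succ (hk : ∀ i, k i + 2 ≤ k (i + 1)) (n i : ℕ) :
    tetrisEntry k a b n i * tetrisEntry k a b n (i + 1) =
      (if n = k (i + 1) then a (i + 1) * b (i + 1) else 0) -
        (if n = k (i + 1) + 1 then a (i + 1) * b (i + 1) else 0) := by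
  have := hk i
  have := hk (i + 1)
  unfold tetrisEntry
  split_ifs <;> first | omega | ring

theorem sum_tetrisEntry_sq_column (hk : ∀ i, k i + 2 ≤ k (i + 1))
    (hab : ∀ i, a i ^ 2 + b i ^ 2 = 1) (hk0 : k 0 = 0) (hb0 : b 0 = 0) {M n : ℕ} (hn : n < k M) :
    ∑ i ∈ Finset.range M, tetrisEntry k a b n i ^ 2 = 1 := by
  simp only [tetrisEntry_sq hk hab]
  rw [Finset.sum_range_sub (fun i => (if n < k i then (1 : ℝ) else 0) +
    (if n = k i then b i ^ 2 else 0) + (if n = k i + 1 then b i ^ 2 else 0))]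
  have h₁ : n ≠ k M := hn.ne
  have h₂ : n ≠ k M + 1 := by omega
  simp [hn, hk0, hb0, h₁, h₂]

theorem add_one_lt_of_lt (hk : ∀ i, k i + 2 ≤ k (i + 1)) {i M : ℕ} (h : i < M) :
    k i + 1 < k M := by
  have hmono : Monotone k := monotone_nat_of_le_succ fun i => by have := hk i; omega
  have := hmono (Nat.succ_le_of_lt h)
  have := hk i
  simp only [Nat.succ_eq_add_one] at *
  omega

theorem sum_range_ite_lt {m N : ℕ} (h : m ≤ N) :
    ∑ n ∈ Finset.range N, (if n < m then (1 : ℝ) else 0) = m := by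
  rw [← Finset.sum_filter, Finset.sum_const, nsmul_one]
  have : (Finset.range N).filter (· < m) = Finset.range m := by
    ext n
    simp only [Finset.mem_filter, Finset.mem_range]
    omega
  rw [this, Finset.card_range]

theorem sum_tetrisEntry_profile (hk : ∀ i, k i + 2 ≤ k (i + 1)) {M j : ℕ} (hbM : b M = 0)
    (hj : j ≤ M) :
    ∑ n ∈ Finset.range (k M), ((if n < k j then (1 : ℝ) else 0) +
      (if n = k j then b j ^ 2 else 0) + (if n = k j + 1 then b j ^ 2 else 0)) =
      k j + 2 * b j ^ 2 := by
  rcases hj.eq_or_lt with rfl | hj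
  · simp [sum_range_ite_lt le_rfl, hbM]
  · have h := add_one_lt_of_lt hk hj
    have h' : k j < k M := by omega
    simp only [Finset.sum_add_distrib, sum_range_ite_lt h'.le, Finset.sum_ite_eq',
      Finset.mem_range, h, h', if_true]
    ring

theorem sum_tetrisEntry_sq_row (hk : ∀ i, k i + 2 ≤ k (i + 1))
    (hab : ∀ i, a i ^ 2 + b i ^ 2 = 1) {M i : ℕ} (hbM : b M = 0) (hi : i < M) :
    ∑ n ∈ Finset.range (k M), tetrisEntry k a b n i ^ 2 =
      (k (i + 1) + 2 * b (i + 1) ^ 2) - (k i + 2 * b i ^ 2) := by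
  simp only [tetrisEntry_sq hk hab]
  rw [Finset.sum_sub_distrib, sum_tetrisEntry_profile hk hbM hi,
    sum_tetrisEntry_profile hk hbM hi.le]

theorem sum_tetrisEntry_mul_of_lt (hk : ∀ i, k i + 2 ≤ k (i + 1)) {M i j : ℕ} (hij : i < j)
    (hj : j < M) :
    ∑ n ∈ Finset.range (k M), tetrisEntry k a b n i * tetrisEntry k a b n j = 0 := by
  rcases (Nat.succ_le_of_lt hij).eq_or_lt with rfl | hij
  · have h := add_one_lt_of_lt hk hj
    simp only [Nat.succ_eq_add_one] at *
    have h' : k (i + 1) < k M := by omega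
    simp [tetrisEntry_mul_succ hk, Finset.sum_sub_distrib, h, h']
  · refine Finset.sum_eq_zero fun n _ => ?_
    have h := add_one_lt_of_lt hk hij
    rcases lt_or_ge n (k j) with hn | hn
    · rw [tetrisEntry_of_lt hn, mul_zero]
    · rw [tetrisEntry_of_gt hk (h.trans_le hn), zero_mul]

theorem sum_tetrisEntry_mul (hk : ∀ i, k i + 2 ≤ k (i + 1))
    (hab : ∀ i, a i ^ 2 + b i ^ 2 = 1) {M i j : ℕ} (hbM : b M = 0) (hi : i < M) (hj : j < M) :
    ∑ n ∈ Finset.range (k M), tetrisEntry k a b n i * tetrisEntry k a b n j =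
      if i = j then (k (i + 1) + 2 * b (i + 1) ^ 2) - (k i + 2 * b i ^ 2) else 0 := by
  split_ifs with h
  · subst h
    simpa only [sq] using sum_tetrisEntry_sq_row hk hab hbM hi
  · rcases lt_or_gt_of_ne h with h | h
    · exact sum_tetrisEntry_mul_of_lt hk h hj
    · simpa only [mul_comm] using sum_tetrisEntry_mul_of_lt (a := a) (b := b) hk h hi

theorem tetrisEntry_mul_eq_zero_of_far (hk : ∀ i, k i + 2 ≤ k (i + 1)) {q : ℕ}
    (hq : ∀ i, k (i + 1) ≤ k i + q + 1) {n n' : ℕ} (h : q + 3 ≤ ((n' : ℤ) - n).natAbs) (i : ℕ) :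
    tetrisEntry k a b n i * tetrisEntry k a b n' i = 0 := by
  have := hq i
  by_cases h₁ : n < k i
  · rw [tetrisEntry_of_lt h₁, zero_mul]
  by_cases h₂ : n' < k i
  · rw [tetrisEntry_of_lt h₂, mul_zero]
  by_cases h₃ : k (i + 1) + 1 < n
  · rw [tetrisEntry_of_gt hk h₃, zero_mul]
  · rw [tetrisEntry_of_gt hk (n := n') (by omega), mul_zero]

end TetrisEntry

theorem span_range_eq_top_of_frame_identity {ι E : Type*} [Fintype ι] [NormedAddCommGroup E]
    [InnerProductSpace ℝ E] {f : ι → E} {A : ℝ} (hA : A ≠ 0)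
    (h : ∀ x, ∑ n, ⟪x, f n⟫ • f n = A • x) : Submodule.span ℝ (Set.range f) = ⊤ := by
  refine Submodule.eq_top_iff'.2 fun x => ?_
  rw [← inv_smul_smul₀ hA x, ← h x]
  exact Submodule.smul_mem _ _ (Submodule.sum_mem _ fun n _ =>
    Submodule.smul_mem _ _ (Submodule.subset_span ⟨n, rfl⟩))

/-- The row boundaries `⌊i N / M⌋` and block entries of the spectral tetris construction. -/
theorem exists_tetris_parameters {M N : ℕ} (hM : 0 < M) (hN : 2 * M ≤ N) :
    ∃ (k : ℕ → ℕ) (a b : ℕ → ℝ), k 0 = 0 ∧ k M = N ∧ b 0 = 0 ∧ b M = 0 ∧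
      (∀ i, k i + 2 ≤ k (i + 1)) ∧ (∀ i, k (i + 1) ≤ k i + N / M + 1) ∧
      (∀ i, a i ^ 2 + b i ^ 2 = 1) ∧ ∀ i, (k i + 2 * b i ^ 2 : ℝ) = i * (N / M) := by
  have hM' : (0 : ℝ) < M := by exact_mod_cast hM
  let r : ℕ → ℝ := fun i => ((i * N % M : ℕ) : ℝ) / M
  have hr0 (i : ℕ) : 0 ≤ r i := by positivity
  have hr1 (i : ℕ) : r i ≤ 1 := by
    refine div_le_one_of_le₀ ?_ hM'.le
    exact_mod_cast (Nat.mod_lt _ hM).le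
  have hb (i : ℕ) : √(r i / 2) ^ 2 = r i / 2 := Real.sq_sqrt (by linarith [hr0 i])
  refine ⟨fun i => i * N / M, fun i => √(1 - r i / 2), fun i => √(r i / 2), by simp,
    Nat.mul_div_cancel_left N hM, by simp [r], by simp [r], fun i => ?_, fun i => ?_,
    fun i => ?_, fun i => ?_⟩
  · change i * N / M + 2 ≤ (i + 1) * N / M
    rw [← Nat.add_mul_div_right _ _ hM]
    exact Nat.div_le_div_right (by linarith)
  · refine Nat.le_of_lt_succ (Nat.div_lt_of_lt_mul ?_)
    have h₁ := Nat.lt_mul_div_succ (i * N) hM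
    have h₂ := Nat.lt_mul_div_succ N hM
    simp only [Nat.succ_eq_add_one]
    linarith
  · rw [hb, Real.sq_sqrt (by linarith [hr1 i])]
    ring
  · have h : ((M * (i * N / M) + i * N % M : ℕ) : ℝ) = (i * N : ℕ) := by rw [Nat.div_add_mod]
    push_cast at h
    simp only [hb, r]
    field_simp
    linarith

/-- for `N ≥ 2M` there is a unit norm tight frame of `N` vectors in `ℝ^M`
such that `⟨f_n, f_{n'}⟩ = 0` whenever `|n' − n| ≥ ⌊N/M⌋ + 3`. -/
theorem stmt_8 (M N : ℕ) (hM : 0 < M) (hN : 2 * M ≤ N) :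
    ∃ f : Fin N → EuclideanSpace ℝ (Fin M),
      Submodule.span ℝ (Set.range f) = ⊤ ∧
      (∀ n, ‖f n‖ = 1) ∧
      (∀ x : EuclideanSpace ℝ (Fin M), ∑ n, ⟪x, f n⟫ • f n = ((N : ℝ) / (M : ℝ)) • x) ∧
      ∀ n n' : Fin N, N / M + 3 ≤ (((n' : ℤ)) - ((n : ℤ))).natAbs → ⟪f n, f n'⟫ = 0 := by
  obtain ⟨k, a, b, hk0, rfl, hb0, hbM, hk, hq, hab, hkb⟩ := exists_tetris_parameters hM hN
  let f : Fin (k M) → EuclideanSpace ℝ (Fin M) := fun n =>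
    WithLp.toLp 2 fun i => tetrisEntry k a b n i
  have hgram (i j : Fin M) : ∑ n : Fin (k M), tetrisEntry k a b n i * tetrisEntry k a b n j =
      if i = j then ((k M : ℝ) / M) else 0 := by
    rw [Fin.sum_univ_eq_sum_range (fun n => tetrisEntry k a b n i * tetrisEntry k a b n j),
      sum_tetrisEntry_mul hk hab hbM i.2 j.2, hkb, hkb]
    simp only [Fin.ext_iff]
    congr 1
    push_cast
    ring
  have htight (x : EuclideanSpace ℝ (Fin M)) :
      ∑ n, ⟪x, f n⟫ • f n = ((k M : ℝ) / M) • x := by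
    ext i
    simp only [f, WithLp.ofLp_sum, Finset.sum_apply, PiLp.smul_apply, PiLp.inner_apply,
      RCLike.inner_apply, conj_trivial, smul_eq_mul, Finset.sum_mul]
    rw [Finset.sum_comm]
    simp only [mul_right_comm _ (x _), ← Finset.sum_mul, hgram]
    simp
  have hA : (k M : ℝ) / M ≠ 0 := by
    have : 0 < k M := by omega
    positivity
  refine ⟨f, span_range_eq_top_of_frame_identity hA htight, fun n => ?_, htight,
    fun n n' h => ?_⟩
  · rw [EuclideanSpace.norm_eq, Real.sqrt_eq_one]
    simp only [f, Real.norm_eq_abs, sq_abs]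
    rw [Fin.sum_univ_eq_sum_range (fun i => tetrisEntry k a b n i ^ 2)]
    exact sum_tetrisEntry_sq_column hk hab hk0 hb0 n.2
  · simp only [f, PiLp.inner_apply, RCLike.inner_apply, conj_trivial]
    refine Finset.sum_eq_zero fun i _ => ?_
    rw [mul_comm]
    exact tetrisEntry_mul_eq_zero_of_far hk hq h i
end

section
/- Let M, N be positive integers with M < N < 2M and set λ = N/M. Then the following two conditions are equivalent: (i) for every integer k with 1 ≤ k ≤ M − 1, if kλ is not an integer then ⌊kλ⌋ ≤ (k+1)λ − 2; (ii) there exists a positive integer L such that N·L = M·(2L − 1), i.e., λ = (2L−1)/L in lowest terms. (Condition (i) characterizes when the Spectral Tetris construction produces a unit norm tight frame of N vectors in ℝ^M with redundancy less than 2, and condition (ii) is the eigenvalue characterization of the same fact.) -/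
theorem floor_mul_div_le_iff {M : ℕ} (hM : 0 < M) (N k : ℕ) :
    (⌊(k : ℝ) * ((N : ℝ) / (M : ℝ))⌋ : ℝ) ≤ ((k : ℝ) + 1) * ((N : ℝ) / (M : ℝ)) - 2 ↔
      2 * M ≤ k * N % M + N := by
  have hMR : (0 : ℝ) < M := by exact_mod_cast hM
  have hfloor : ⌊(k : ℝ) * ((N : ℝ) / (M : ℝ))⌋ = ((k * N / M : ℕ) : ℤ) := by
    rw [← mul_div_assoc, ← Nat.cast_mul, ← Int.natCast_floor_eq_floor (by positivity),
      Nat.floor_div_eq_div]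
  have hdiv : (k * N % M : ℕ) + (M : ℝ) * (k * N / M : ℕ) = k * N := by
    exact_mod_cast Nat.mod_add_div (k * N) M
  rw [hfloor, Int.cast_natCast, ← mul_div_assoc, le_sub_iff_add_le, le_div_iff₀ hMR,
    ← Nat.cast_le (α := ℝ)]
  simp only [Nat.cast_add, Nat.cast_mul, Nat.cast_ofNat]
  constructor <;> intro h <;> linarith

theorem exists_int_eq_mul_div_iff {M : ℕ} (hM : 0 < M) (N k : ℕ) :
    (∃ z : ℤ, (k : ℝ) * ((N : ℝ) / (M : ℝ)) = (z : ℝ)) ↔ k * N % M = 0 := by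
  have hMR : (M : ℝ) ≠ 0 := by exact_mod_cast hM.ne'
  rw [← Nat.dvd_iff_mod_eq_zero, ← Int.natCast_dvd_natCast]
  refine exists_congr fun z => ?_
  rw [← mul_div_assoc, div_eq_iff hMR, mul_comm (z : ℝ)]
  norm_cast

/-- for `M < N < 2M` and `λ = N/M`, the Spectral Tetris floor condition
(i) holds for all `1 ≤ k ≤ M−1` if and only if (ii) `λ = (2L−1)/L` in lowest terms,
i.e. `N·L = M·(2L−1)` for some positive integer `L`. -/
theorem stmt_9 (M N : ℕ) (hM : 0 < M) (h1 : M < N) (h2 : N < 2 * M) :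
    (∀ k : ℕ, 1 ≤ k → k ≤ M - 1 →
        (¬ ∃ z : ℤ, (k : ℝ) * ((N : ℝ) / (M : ℝ)) = (z : ℝ)) →
        (⌊(k : ℝ) * ((N : ℝ) / (M : ℝ))⌋ : ℝ)
          ≤ ((k : ℝ) + 1) * ((N : ℝ) / (M : ℝ)) - 2)
      ↔ (∃ L : ℕ, 0 < L ∧ N * L = M * (2 * L - 1)) := by
  simp only [floor_mul_div_le_iff hM, exists_int_eq_mul_div_iff hM]
  constructor
  · intro h
    have hgM : N.gcd M < M := by
      refine lt_of_le_of_ne (Nat.gcd_le_right N hM) fun he => ?_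
      obtain ⟨c, hc⟩ := Nat.gcd_eq_right_iff_dvd.mp he
      have hc1 : 1 < c := by by_contra! hle; nlinarith
      have hc2 : c < 2 := by by_contra! hle; nlinarith
      omega
    have hg : 0 < N.gcd M := Nat.gcd_pos_of_pos_right N hM
    obtain ⟨k, hkM, hk⟩ := Nat.exists_mul_mod_eq_gcd hgM
    rw [mul_comm] at hk
    have hk0 : 1 ≤ k := by
      by_contra! h0
      rw [Nat.lt_one_iff.mp h0, zero_mul, Nat.zero_mod] at hk
      omega
    have hle := h k hk0 (Nat.le_sub_one_of_lt hkM) (by omega)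
    have hdvd : N.gcd M ∣ 2 * M - N :=
      Nat.dvd_sub ((Nat.gcd_dvd_right N M).mul_left 2) (Nat.gcd_dvd_left N M)
    have hge := Nat.le_of_dvd (by omega) hdvd
    obtain ⟨L, hL⟩ := Nat.gcd_dvd_right N M
    have hL0 : 0 < L := by
      by_contra! h0
      simp [Nat.le_zero.mp h0] at hL
      omega
    have hN : N + N.gcd M = 2 * M := by omega
    refine ⟨L, hL0, ?_⟩
    zify [show 1 ≤ 2 * L by omega] at hN hL ⊢
    linear_combination L * hN + hL
  · rintro ⟨L, hL0, hL⟩ k - - hk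
    have hdvd : 2 * M - N ∣ M := by
      refine ⟨L, ?_⟩
      zify [h2.le, show 1 ≤ 2 * L by omega] at hL ⊢
      linear_combination hL
    have hdvdN : 2 * M - N ∣ N := by
      have := Nat.dvd_sub (hdvd.mul_left 2) (dvd_refl (2 * M - N))
      rwa [Nat.sub_sub_self h2.le] at this
    have := Nat.le_of_dvd (Nat.pos_of_ne_zero hk)
      ((Nat.dvd_mod_iff hdvd).mpr (hdvdN.mul_left k))
    omega
end

section
/- Suppose real numbers N ≥ λ_1 ≥ λ_2 ≥ … ≥ λ_M ≥ 2 and a positive integer N satisfy Σ_{m=1}^M λ_m = N, and suppose that for every index m_0 ∈ {1,…,M} for which λ_{m_0} is not an integer, one has ⌊λ_{m_0}⌋ ≤ N − 3. Then there exists a unit norm frame {f_n}_{n=1}^N for ℝ^M whose frame operator has eigenvalues λ_1,…,λ_M (with multiplicity) and such that every frame vector f_n is 2-sparse with respect to the standard basis. -/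
open scoped RealInnerProductSpace

/-- `DiagonalFrame μ N` says that there are `N` unit vectors, each with at most two nonzero
coordinates, whose frame operator is the diagonal operator with diagonal `μ`. -/
def DiagonalFrame {ι : Type*} [Fintype ι] [DecidableEq ι] (μ : ι → ℝ) (N : ℕ) : Prop :=
  ∃ F : Fin N → ι → ℝ,
    (∀ i j, ∑ n, F n i * F n j = if i = j then μ i else 0) ∧
    (∀ n, ∑ i, F n i ^ 2 = 1) ∧
    ∀ n, {m | F n m ≠ 0}.ncard ≤ 2

namespace DiagonalFrame

variable {ι : Type*} [Fintype ι] [DecidableEq ι]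

theorem zero : DiagonalFrame (0 : ι → ℝ) 0 :=
  ⟨fun n => n.elim0, by simp, fun n => n.elim0, fun n => n.elim0⟩

theorem add {μ ν : ι → ℝ} {N K : ℕ} (hμ : DiagonalFrame μ N) (hν : DiagonalFrame ν K) :
    DiagonalFrame (μ + ν) (N + K) := by
  obtain ⟨F, hF, hF1, hF2⟩ := hμ
  obtain ⟨G, hG, hG1, hG2⟩ := hν
  refine ⟨Fin.append F G, fun i j => ?_, fun n => ?_, fun n => ?_⟩
  · simp only [Fin.sum_univ_add, Fin.append_left, Fin.append_right, hF, hG, Pi.add_apply]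
    split_ifs <;> simp
  · induction n using Fin.addCases with
    | left n => simpa using hF1 n
    | right n => simpa using hG1 n
  · induction n using Fin.addCases with
    | left n => simpa using hF2 n
    | right n => simpa using hG2 n

theorem single_one (i : ι) : DiagonalFrame (Pi.single i 1 : ι → ℝ) 1 := by
  refine ⟨fun _ => Pi.single i 1, fun a b => ?_, fun _ => ?_, fun _ => ?_⟩
  · simp only [Pi.single_apply, Finset.univ_unique, Finset.sum_singleton]
    split_ifs <;> simp_all
  · simp [Pi.single_apply]
  · refine (Set.ncard_le_ncard (t := {i}) (fun m hm => ?_) (Set.toFinite _)).trans (by simp)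
    by_contra h
    simp_all

theorem single_natCast (i : ι) (k : ℕ) : DiagonalFrame (Pi.single i (k : ℝ) : ι → ℝ) k := by
  induction k with
  | zero => simpa using zero (ι := ι)
  | succ k ih => simpa [Pi.single_add] using ih.add (single_one i)

theorem single_add_single {i j : ι} (hij : i ≠ j) {r : ℝ} (h0 : 0 ≤ r) (h2 : r ≤ 2) :
    DiagonalFrame (Pi.single i r + Pi.single j (2 - r) : ι → ℝ) 2 := by
  have ha : √(r / 2) * √(r / 2) = r / 2 := Real.mul_self_sqrt (by linarith)
  have hb : √(1 - r / 2) * √(1 - r / 2) = 1 - r / 2 := Real.mul_self_sqrt (by linarith)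
  set a := √(r / 2)
  set b := √(1 - r / 2)
  have norm_eq (c : ℝ) (hc : c * c = 1 - r / 2) :
      ∑ k, (Pi.single i a + Pi.single j c : ι → ℝ) k ^ 2 = 1 := by
    have h (k : ι) : (Pi.single i a + Pi.single j c : ι → ℝ) k ^ 2 =
        (if k = i then a * a else 0) + (if k = j then c * c else 0) := by
      simp only [Pi.add_apply, Pi.single_apply]
      split_ifs with h1 h2
      · exact absurd (h1.symm.trans h2) hij
      all_goals ring
    simp only [h, Finset.sum_add_distrib, Finset.sum_ite_eq', Finset.mem_univ, if_true]
    linarith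
  have sparse (c : ℝ) : {m | (Pi.single i a + Pi.single j c : ι → ℝ) m ≠ 0}.ncard ≤ 2 := by
    refine (Set.ncard_le_ncard (t := {i, j}) (fun m hm => ?_) (Set.toFinite _)).trans
      (Set.ncard_pair hij).le
    by_contra h
    simp_all
  refine ⟨![Pi.single i a + Pi.single j b, Pi.single i a + Pi.single j (-b)],
    fun k l => ?_, ?_, ?_⟩
  · simp only [Fin.sum_univ_two, Matrix.cons_val_zero, Matrix.cons_val_one, Pi.add_apply,
      Pi.single_apply]
    split_ifs <;> first | (exfalso; simp_all; done) | linarith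
  · simpa [Fin.forall_fin_two] using ⟨norm_eq b hb, norm_eq (-b) (by linarith)⟩
  · simpa [Fin.forall_fin_two] using ⟨sparse b, sparse (-b)⟩

/-- The Spectral Tetris construction: the rows in `s` are filled one after the other, starting
from a row `i` in which the weight `r` is still missing. -/
theorem single_add_sum_single (lam : ι → ℝ) (s : Finset ι) (hs : ∀ j ∈ s, 2 ≤ lam j) :
    ∀ (i : ι) (r : ℝ) (N : ℕ), i ∉ s → 0 ≤ r → r + ∑ j ∈ s, lam j = N →
      DiagonalFrame (Pi.single i r + ∑ j ∈ s, Pi.single j (lam j)) N := by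
  induction s using Finset.induction_on with
  | empty =>
    intro i r N _ _ h
    obtain rfl : r = N := by simpa using h
    simpa using single_natCast i N
  | insert j s hj ih =>
    intro i r N hi hr h
    rw [Finset.sum_insert hj] at h ⊢
    have hij : i ≠ j := by rintro rfl; simp at hi
    have hlamj : 2 ≤ lam j := hs j (by simp)
    have hs' : ∀ k ∈ s, 2 ≤ lam k := fun k hk => hs k (Finset.mem_insert_of_mem hk)
    have hnonneg : 0 ≤ ∑ k ∈ s, lam k :=
      Finset.sum_nonneg fun k hk => zero_le_two.trans (hs' k hk)
    have hk := Nat.floor_le hr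
    have hk' := Nat.lt_floor_add_one r
    set k := ⌊r⌋₊
    obtain ⟨K, rfl⟩ : ∃ K, N = k + 2 + K := by
      refine Nat.exists_eq_add_of_le ?_
      have : ((k + 2 : ℕ) : ℝ) ≤ N := by push_cast; linarith
      exact_mod_cast this
    push_cast at h
    have hrest := ih hs' j (lam j - (2 - (r - k))) K hj (by linarith) (by linarith)
    have hpair := single_add_single hij (r := r - k) (by linarith) (by linarith)
    convert ((single_natCast i k).add hpair).add hrest using 1
    have hi : (Pi.single i r : ι → ℝ) = Pi.single i (k : ℝ) + Pi.single i (r - k) := by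
      rw [← Pi.single_add]; simp
    have hj : (Pi.single j (lam j) : ι → ℝ) =
        Pi.single j (2 - (r - k)) + Pi.single j (lam j - (2 - (r - k))) := by
      rw [← Pi.single_add]; simp
    rw [hi, hj]
    abel

theorem of_two_le [Nonempty ι] {lam : ι → ℝ} {N : ℕ} (h2 : ∀ i, 2 ≤ lam i)
    (hsum : ∑ i, lam i = N) : DiagonalFrame lam N := by
  obtain ⟨i⟩ := ‹Nonempty ι›
  have h := single_add_sum_single lam (Finset.univ.erase i) (fun j _ => h2 j) i (lam i) N
    (by simp) (zero_le_two.trans (h2 i)) (by simpa using hsum)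
  rwa [Finset.add_sum_erase _ (fun j => Pi.single j (lam j)) (Finset.mem_univ i),
    Finset.univ_sum_single] at h

end DiagonalFrame

/-- sufficiency of the SFR conditions.  If `N ≥ λ_1 ≥ … ≥ λ_M ≥ 2` with
`Σ λ_m = N` and every non-integer `λ_{m_0}` satisfies `⌊λ_{m_0}⌋ ≤ N − 3`, then there is a
unit norm frame of `N` vectors in `ℝ^M` with eigenvalues `λ_1,…,λ_M` all of whose vectors
are 2-sparse with respect to the standard basis. -/
theorem stmt_10 (M N : ℕ) (hM : 0 < M)
    (lam : Fin M → ℝ) (hmono : Antitone lam)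
    (h2 : ∀ m, 2 ≤ lam m) (hNle : ∀ m, lam m ≤ (N : ℝ))
    (hsum : ∑ m, lam m = N)
    (hfloor : ∀ m : Fin M, (¬ ∃ z : ℤ, lam m = (z : ℝ)) → (⌊lam m⌋ : ℝ) ≤ (N : ℝ) - 3) :
    ∃ f : Fin N → EuclideanSpace ℝ (Fin M),
      Submodule.span ℝ (Set.range f) = ⊤ ∧
      (∀ n, ‖f n‖ = 1) ∧
      (∃ b : OrthonormalBasis (Fin M) ℝ (EuclideanSpace ℝ (Fin M)),
        ∀ m, ∑ n, ⟪b m, f n⟫ • f n = lam m • b m) ∧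
      ∀ n, {m : Fin M | f n m ≠ 0}.ncard ≤ 2 := by
  have : Nonempty (Fin M) := ⟨⟨0, hM⟩⟩
  obtain ⟨F, hF, hF1, hF2⟩ := DiagonalFrame.of_two_le h2 hsum
  let f : Fin N → EuclideanSpace ℝ (Fin M) := fun n => WithLp.toLp 2 (F n)
  let b := EuclideanSpace.basisFun (Fin M) ℝ
  have hb (m : Fin M) : ∑ n, ⟪b m, f n⟫ • f n = lam m • b m := by
    ext j
    simpa [f, b, EuclideanSpace.inner_single_left, Pi.single_apply, eq_comm] using hF m j
  refine ⟨f, ?_, fun n => ?_, ⟨b, hb⟩, hF2⟩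
  · rw [eq_top_iff, ← b.toBasis.span_eq, Submodule.span_le]
    rintro _ ⟨m, rfl⟩
    have hm : lam m ≠ 0 := by linarith [h2 m]
    rw [SetLike.mem_coe, ← Submodule.smul_mem_iff _ hm, b.coe_toBasis, ← hb m]
    exact Submodule.sum_mem _ fun n _ =>
      Submodule.smul_mem _ _ (Submodule.subset_span (Set.mem_range_self n))
  · simp [EuclideanSpace.norm_eq, f, hF1]
end

section
/- Let {a_n}_{n=1}^N ⊆ (0,∞) and {λ_m}_{m=1}^M ⊆ (0,∞) be sequences for which there exist permutations making {a_n}_{n=1}^N and {λ_m}_{m=1}^M Spectral Tetris ready. Then there exists a frame {f_n}_{n=1}^N for ℝ^M whose multiset of vector norms is {a_1,…,a_N}, whose frame operator has eigenvalues λ_1,…,λ_M (as a multiset, with multiplicity), and such that every frame vector f_n is 2-sparse with respect to the standard basis. -/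
open scoped RealInnerProductSpace

/-- The sequences `a_1,…,a_N` and `λ_1,…,λ_M` (here 0-indexed: `a ⟨i⟩ = a_{i+1}`) are
*Spectral Tetris ready*: `Σ a_n² = Σ λ_m` and there is a partition
`0 ≤ n_1 < n_2 < … < n_M = N` (here `p ⟨k⟩ = n_{k+1}`) such that for all `k = 1,…,M−1`:
(1) `Σ_{n=1}^{n_k} a_n² ≤ Σ_{m=1}^k λ_m < Σ_{n=1}^{n_k+1} a_n²`, and
(2) if `Σ_{n=1}^{n_k} a_n² < Σ_{m=1}^k λ_m`, then `n_{k+1} − n_k ≥ 2` and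
    `a_{n_k+2}² ≥ Σ_{m=1}^k λ_m − Σ_{n=1}^{n_k} a_n²`. -/
def SpectralTetrisReady {N M : ℕ} (a : Fin N → ℝ) (lam : Fin M → ℝ) : Prop :=
  ∑ n, a n ^ 2 = ∑ m, lam m ∧
  ∃ p : Fin M → ℕ,
    StrictMono p ∧
    (∀ k, p k ≤ N) ∧
    (∀ k : Fin M, (k : ℕ) = M - 1 → p k = N) ∧
    ∀ j : Fin M, ∀ hj : (j : ℕ) < M - 1,
      (∑ n ∈ Finset.univ.filter (fun n : Fin N => (n : ℕ) < p j), a n ^ 2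
          ≤ ∑ m ∈ Finset.univ.filter (fun m : Fin M => (m : ℕ) ≤ (j : ℕ)), lam m) ∧
      (∑ m ∈ Finset.univ.filter (fun m : Fin M => (m : ℕ) ≤ (j : ℕ)), lam m
          < ∑ n ∈ Finset.univ.filter (fun n : Fin N => (n : ℕ) < p j + 1), a n ^ 2) ∧
      ((∑ n ∈ Finset.univ.filter (fun n : Fin N => (n : ℕ) < p j), a n ^ 2
          < ∑ m ∈ Finset.univ.filter (fun m : Fin M => (m : ℕ) ≤ (j : ℕ)), lam m) →
        2 ≤ p ⟨(j : ℕ) + 1, by have := j.isLt; omega⟩ - p j ∧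
        ∀ h2 : p j + 1 < N,
          (∑ m ∈ Finset.univ.filter (fun m : Fin M => (m : ℕ) ≤ (j : ℕ)), lam m)
              - ∑ n ∈ Finset.univ.filter (fun n : Fin N => (n : ℕ) < p j), a n ^ 2
            ≤ a ⟨p j + 1, h2⟩ ^ 2)

/-- A `2 × 2` matrix with orthogonal rows, first row of squared norm `r`, and columns of squared
norms `α` and `β`. -/
lemma exists_two_by_two {r α β : ℝ} (hr : 0 ≤ r) (hα : r < α) (hβ : r ≤ β) :
    ∃ x y z w : ℝ, x ^ 2 + z ^ 2 = r ∧ x * y + z * w = 0 ∧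
      x ^ 2 + y ^ 2 = α ∧ z ^ 2 + w ^ 2 = β := by
  have hd : 0 < α + β - 2 * r := by linarith
  have hr2 := Real.sq_sqrt hr
  have hs2 := Real.sq_sqrt (show 0 ≤ α + β - r by linarith)
  have hc2 := Real.sq_sqrt (show 0 ≤ (β - r) / (α + β - 2 * r) from
    div_nonneg (by linarith) hd.le)
  have he2 := Real.sq_sqrt (show 0 ≤ (α - r) / (α + β - 2 * r) from
    div_nonneg (by linarith) hd.le)
  set c := √((β - r) / (α + β - 2 * r))
  set e := √((α - r) / (α + β - 2 * r))
  refine ⟨√r * c, -(√(α + β - r) * e), √r * e, √(α + β - r) * c, ?_, by ring, ?_, ?_⟩ <;>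
    simp only [mul_pow, neg_sq, hr2, hs2, hc2, he2] <;>
    rw [← mul_div_assoc, ← mul_div_assoc, ← add_div, div_eq_iff hd.ne'] <;> ring

/-- Splitting the weights `a i ^ 2` over a finite set `S` into two orthogonal rows, the first of
squared norm `r`. -/
lemma exists_orthogonal_rows {ι : Type*} [DecidableEq ι] (S : Finset ι) (a : ι → ℝ) {r : ℝ}
    (h : r = 0 ∨ 0 ≤ r ∧ ∃ i ∈ S, ∃ j ∈ S, i ≠ j ∧ r < a i ^ 2 ∧ r ≤ a j ^ 2) :
    ∃ t b : ι → ℝ, ∑ n ∈ S, t n ^ 2 = r ∧ ∑ n ∈ S, t n * b n = 0 ∧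
      ∀ n, t n ^ 2 + b n ^ 2 = a n ^ 2 := by
  rcases h with rfl | ⟨hr, i, hi, j, hj, hij, hai, haj⟩
  · exact ⟨0, a, by simp, by simp, by simp⟩
  obtain ⟨x, y, z, w, h1, h2, h3, h4⟩ := exists_two_by_two hr hai haj
  refine ⟨fun n => if n = i then x else if n = j then z else 0,
    fun n => if n = i then y else if n = j then w else a n, ?_, ?_, ?_⟩
  · rw [Finset.sum_eq_add_of_mem i j hi hj hij (by intro c _ hc; simp [hc.1, hc.2])]
    simpa [hij.symm] using h1
  · rw [Finset.sum_eq_add_of_mem i j hi hj hij (by intro c _ hc; simp [hc.1, hc.2])]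
    simpa [hij.symm] using h2
  · intro n
    by_cases hni : n = i
    · subst hni; simpa using h3
    · by_cases hnj : n = j
      · subst hnj; simpa [hni] using h4
      · simp [hni, hnj]

/-- A block bidiagonal family: the vector with label `κ n` has entry `b n` in row `κ n` and entry
`t n` in the preceding row. -/
lemma exists_two_sparse_of_blocks {N M : ℕ} (a : Fin N → ℝ) (lam : Fin M → ℝ)
    (κ : Fin N → ℕ) (t b : Fin N → ℝ) (hκ : ∀ n, κ n < M)
    (ht0 : ∀ n, κ n = 0 → t n = 0) (hnorm : ∀ n, t n ^ 2 + b n ^ 2 = a n ^ 2)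
    (horth : ∀ k, ∑ n with κ n = k, t n * b n = 0)
    (hrow : ∀ m : Fin M, ∑ n with κ n = m, b n ^ 2 + ∑ n with κ n = m + 1, t n ^ 2 = lam m) :
    ∃ F : Fin N → Fin M → ℝ, (∀ n, ∑ m, F n m ^ 2 = a n ^ 2) ∧
      (∀ m m', ∑ n, F n m * F n m' = if m = m' then lam m else 0) ∧
      ∀ n, {m | F n m ≠ 0}.ncard ≤ 2 := by
  let F : Fin N → Fin M → ℝ := fun n m =>
    (if κ n = m then b n else 0) + if κ n = m + 1 then t n else 0
  have hsucc : ∀ m m' : Fin M, (m' : ℕ) = m + 1 → ∑ n, F n m * F n m' = 0 := by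
    intro m m' h
    rw [← horth (m + 1), Finset.sum_filter]
    refine Finset.sum_congr rfl fun n _ => ?_
    simp only [F, h]
    split_ifs <;> first | omega | ring
  refine ⟨F, fun n => ?_, fun m m' => ?_, fun n => ?_⟩
  · have hsq : ∀ m, F n m ^ 2 =
        (if κ n = m then b n ^ 2 else 0) + if κ n = m + 1 then t n ^ 2 else 0 := by
      intro m
      simp only [F]
      split_ifs <;> first | omega | ring
    simp only [hsq, Finset.sum_add_distrib, ← hnorm n]
    rw [add_comm]
    congr 1
    · rcases Nat.eq_zero_or_pos (κ n) with h0 | h0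
      · simp [ht0 n h0]
      · rw [Finset.sum_eq_single (⟨κ n - 1, by have := hκ n; omega⟩ : Fin M)]
        · rw [if_pos (by simp; omega)]
        · intro c _ hc
          rw [if_neg]
          intro h
          exact hc (Fin.ext (by simp; omega))
        · simp
    · rw [Finset.sum_eq_single (⟨κ n, hκ n⟩ : Fin M)]
      · simp
      · intro c _ hc
        rw [if_neg]
        intro h
        exact hc (Fin.ext (by simp; omega))
      · simp
  · by_cases hmm : m = m'
    · subst hmm
      rw [if_pos rfl, ← hrow m, Finset.sum_filter, Finset.sum_filter, ← Finset.sum_add_distrib]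
      refine Finset.sum_congr rfl fun n _ => ?_
      simp only [F]
      split_ifs <;> first | omega | ring
    rw [if_neg hmm]
    have hne : (m : ℕ) ≠ m' := fun h => hmm (Fin.ext h)
    by_cases h1 : (m' : ℕ) = m + 1
    · exact hsucc m m' h1
    by_cases h2 : (m : ℕ) = m' + 1
    · simpa only [mul_comm] using hsucc m' m h2
    refine Finset.sum_eq_zero fun n _ => ?_
    simp only [F]
    split_ifs <;> first | omega | ring
  · have hsub : {m | F n m ≠ 0} ⊆
        ({⟨κ n, hκ n⟩, ⟨κ n - 1, by have := hκ n; omega⟩} : Set (Fin M)) := by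
      intro m hm
      simp only [Set.mem_insert_iff, Set.mem_singleton_iff, Fin.ext_iff]
      by_contra hcon
      refine hm ?_
      simp only [F]
      rw [if_neg (by omega), if_neg (by omega), add_zero]
    exact (Set.ncard_le_ncard hsub).trans ((Set.ncard_insert_le _ _).trans (by simp))

/-- The Spectral Tetris construction for sequences that are already ordered. -/
lemma SpectralTetrisReady.exists_two_sparse {N M : ℕ} (hM : 0 < M) {a : Fin N → ℝ}
    {lam : Fin M → ℝ} (h : SpectralTetrisReady a lam) :
    ∃ F : Fin N → Fin M → ℝ, (∀ n, ∑ m, F n m ^ 2 = a n ^ 2) ∧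
      (∀ m m', ∑ n, F n m * F n m' = if m = m' then lam m else 0) ∧
      ∀ n, {m | F n m ≠ 0}.ncard ≤ 2 := by
  obtain ⟨htot, p, hp, hpN, hpM, hstep⟩ := h
  obtain ⟨q, hq0, hqs, hqM⟩ : ∃ q : ℕ → ℕ, q 0 = 0 ∧ (∀ j : Fin M, q (j + 1) = p j) ∧
      ∀ k, M ≤ k → q k = N := by
    refine ⟨fun k => if k = 0 then 0 else if h : k - 1 < M then
      p ⟨k - 1, h⟩ else N, by simp, fun j => by simp, fun k hk => ?_⟩
    simp only
    rw [if_neg (by omega)]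
    split_ifs with h
    · exact hpM _ (by simp; omega)
    · rfl
  have hqmono : Monotone q := by
    refine monotone_nat_of_le_succ fun k => ?_
    rcases lt_or_ge k M with hk | hk
    · rcases k with _ | k
      · simp [hq0]
      · have h1 := hqs ⟨k, by omega⟩
        have h2 := hqs ⟨k + 1, hk⟩
        simp only at h1 h2
        rw [h1, h2]
        exact hp.monotone (Fin.mk_le_mk.2 (by omega))
    · rw [hqM k hk, hqM (k + 1) (by omega)]
  have hex : ∀ n : Fin N, ∃ k, (n : ℕ) < q (k + 1) := fun n => ⟨M, by
    rw [hqM _ (by omega)]; exact n.isLt⟩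
  let κ : Fin N → ℕ := fun n => Nat.find (hex n)
  have hκ : ∀ n k, κ n = k ↔ q k ≤ n ∧ (n : ℕ) < q (k + 1) := by
    intro n k
    rw [Nat.find_eq_iff]
    refine ⟨fun ⟨h1, h2⟩ => ⟨?_, h1⟩, fun ⟨h1, h2⟩ => ⟨h2, fun j hj => ?_⟩⟩
    · rcases k with _ | k
      · simp [hq0]
      · exact not_lt.1 (h2 k (by omega))
    · exact not_lt.2 ((hqmono (by omega)).trans h1)
  have hκM : ∀ n, κ n < M := by
    intro n
    by_contra hcon
    have h1 := ((hκ n _).1 rfl).1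
    rw [hqM _ (not_lt.1 hcon)] at h1
    omega
  let A : ℕ → ℝ := fun k => ∑ n with (n : Fin N).val < k, a n ^ 2
  let L : ℕ → ℝ := fun k => ∑ m with (m : Fin M).val < k, lam m
  have hAsucc : ∀ k (hk : k < N), A (k + 1) = A k + a ⟨k, hk⟩ ^ 2 := by
    intro k hk
    have : (Finset.univ.filter fun n : Fin N => n.val < k + 1) =
        insert ⟨k, hk⟩ (Finset.univ.filter fun n : Fin N => n.val < k) := by
      ext n; simp [Fin.ext_iff]; omega
    simp only [A]
    rw [this, Finset.sum_insert (by simp), add_comm]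
  have hLsucc : ∀ m : Fin M, L (m + 1) = L m + lam m := by
    intro m
    have : (Finset.univ.filter fun n : Fin M => n.val < m + 1) =
        insert m (Finset.univ.filter fun n : Fin M => n.val < m) := by
      ext n; simp [Fin.ext_iff]; omega
    simp only [L]
    rw [this, Finset.sum_insert (by simp), add_comm]
  have hAblock : ∀ k, ∑ n with κ n = k, a n ^ 2 = A (q (k + 1)) - A (q k) := by
    intro k
    have hk := hqmono (Nat.le_succ k)
    simp only [A, Finset.sum_filter, ← Finset.sum_sub_distrib, hκ]
    refine Finset.sum_congr rfl fun n _ => ?_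
    simp only [Nat.succ_eq_add_one] at hk
    split_ifs <;> first | omega | ring
  have hLM : ∀ k, M ≤ k → L k - A (q k) = 0 := by
    intro k hk
    simp only [hqM k hk, A, L]
    rw [Finset.filter_true_of_mem fun (n : Fin M) _ => n.isLt.trans_le hk,
      Finset.filter_true_of_mem fun (n : Fin N) _ => n.isLt, htot, sub_self]
  have hrows : ∀ k, ∃ t b : Fin N → ℝ, ∑ n with κ n = k, t n ^ 2 = L k - A (q k) ∧
      ∑ n with κ n = k, t n * b n = 0 ∧ ∀ n, t n ^ 2 + b n ^ 2 = a n ^ 2 := by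
    intro k
    refine exists_orthogonal_rows _ _ ?_
    rcases Nat.eq_zero_or_pos k with rfl | hk0
    · left; simp [L, A, hq0]
    rcases le_or_gt M k with hkM | hkM
    · exact Or.inl (hLM k hkM)
    obtain ⟨j, rfl⟩ : ∃ j, k = j + 1 := ⟨k - 1, by omega⟩
    obtain ⟨h1, h2, h3⟩ := hstep ⟨j, by omega⟩ (by simp; omega)
    have hqj := hqs ⟨j, by omega⟩
    have hqj' := hqs ⟨j + 1, hkM⟩
    simp only at hqj hqj'
    simp only [← Nat.lt_succ_iff, Nat.succ_eq_add_one, ← hqj, ← hqj'] at h1 h2 h3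
    change A (q (j + 1)) ≤ L (j + 1) at h1
    change L (j + 1) < A (q (j + 1) + 1) at h2
    change A (q (j + 1)) < L (j + 1) → _ ∧ ∀ _, L (j + 1) - A (q (j + 1)) ≤ _ at h3
    rcases h1.eq_or_lt with h1 | h1
    · left; linarith
    obtain ⟨h4, h5⟩ := h3 h1
    have hle : q (j + 1 + 1) ≤ N := hqj' ▸ hpN _
    refine Or.inr ⟨by linarith, ⟨q (j + 1), by omega⟩, ?_, ⟨q (j + 1) + 1, by omega⟩, ?_, ?_, ?_,
      h5 (by omega)⟩
    · simp only [Finset.mem_filter_univ, hκ]; omega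
    · simp only [Finset.mem_filter_univ, hκ]; omega
    · simp
    · rw [hAsucc _ (by omega)] at h2
      linarith
  choose t b ht htb hnorm using hrows
  have hcongr : ∀ (g : ℕ → Fin N → ℝ) k,
      ∑ n with κ n = k, g (κ n) n = ∑ n with κ n = k, g k n := fun g k =>
    Finset.sum_congr rfl fun n hn => by rw [(Finset.mem_filter_univ n).1 hn]
  refine exists_two_sparse_of_blocks a lam κ (fun n => t (κ n) n) (fun n => b (κ n) n) hκM
    (fun n hn => ?_) (fun n => hnorm _ n) (fun k => ?_) (fun m => ?_)
  · have h0 : ∑ n with κ n = 0, t 0 n ^ 2 = 0 := by rw [ht 0]; simp [L, A, hq0]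
    rw [Finset.sum_eq_zero_iff_of_nonneg fun _ _ => sq_nonneg _] at h0
    have := h0 n (by simpa using hn)
    simpa [hn] using this
  · rw [hcongr (fun k n => t k n * b k n), htb]
  · rw [hcongr (fun k n => b k n ^ 2), hcongr (fun k n => t k n ^ 2), ht]
    have h1 : ∑ n with κ n = m, (t m n ^ 2 + b m n ^ 2) = A (q (m + 1)) - A (q m) := by
      simp only [hnorm, hAblock]
    rw [Finset.sum_add_distrib, ht] at h1
    linarith [hLsucc m]

/-- if the norm sequence and eigenvalue sequence admit permutations making them
Spectral Tetris ready, then there is a 2-sparse frame of `N` vectors in `ℝ^M` with exactly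
these vector norms (as a multiset) and these eigenvalues (as a multiset). -/
theorem stmt_12 (M N : ℕ) (hM : 0 < M)
    (a : Fin N → ℝ) (ha : ∀ n, 0 < a n)
    (lam : Fin M → ℝ) (hlam : ∀ m, 0 < lam m)
    (hready : ∃ (σ : Equiv.Perm (Fin N)) (τ : Equiv.Perm (Fin M)),
      SpectralTetrisReady (a ∘ σ) (lam ∘ τ)) :
    ∃ f : Fin N → EuclideanSpace ℝ (Fin M),
      Submodule.span ℝ (Set.range f) = ⊤ ∧
      (Finset.univ.val.map fun n => ‖f n‖) = Finset.univ.val.map a ∧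
      (∃ b : OrthonormalBasis (Fin M) ℝ (EuclideanSpace ℝ (Fin M)),
        ∀ m, ∑ n, ⟪b m, f n⟫ • f n = lam m • b m) ∧
      ∀ n, {m : Fin M | f n m ≠ 0}.ncard ≤ 2 := by
  obtain ⟨σ, τ, h⟩ := hready
  obtain ⟨F, hF, hG, hS⟩ := h.exists_two_sparse hM
  let f : Fin N → EuclideanSpace ℝ (Fin M) := fun n => WithLp.toLp 2 (F n)
  let b := (EuclideanSpace.basisFun (Fin M) ℝ).reindex τ
  have hb : ∀ m, ∑ n, ⟪b m, f n⟫ • f n = lam m • b m := by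
    intro m
    ext i
    have hG' := hG (τ.symm m) i
    simpa [b, f, EuclideanSpace.inner_single_left, Pi.single_apply, eq_comm] using hG'
  refine ⟨f, ?_, ?_, ⟨b, hb⟩, hS⟩
  · rw [eq_top_iff, ← b.toBasis.span_eq, Submodule.span_le]
    rintro _ ⟨m, rfl⟩
    have hmem : lam m • b m ∈ Submodule.span ℝ (Set.range f) := by
      rw [← hb m]
      exact Submodule.sum_mem _ fun n _ =>
        Submodule.smul_mem _ _ (Submodule.subset_span ⟨n, rfl⟩)
    simpa using (Submodule.smul_mem_iff _ (hlam m).ne').1 hmem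
  · have hn : ∀ n, ‖f n‖ = a (σ n) := by
      intro n
      rw [← sq_eq_sq₀ (norm_nonneg _) (ha _).le, EuclideanSpace.real_norm_sq_eq]
      exact hF n
    simp only [hn]
    exact (Multiset.map_map a σ _).symm.trans (by rw [Multiset.map_univ_val_equiv])
end

section
/- Let {a_n}_{n=1}^N ⊆ (0,∞) and {λ_m}_{m=1}^M ⊆ (0,∞) be non-decreasing sequences with N ≥ 2M such that Σ_{n=1}^N a_n² = Σ_{m=1}^M λ_m and a_{N−2L}² + a_{N−2L−1}² ≤ λ_{M−L} for every L = 0, 1, …, M−1. Then {a_n}_{n=1}^N and {λ_m}_{m=1}^M are Spectral Tetris ready. In particular, this holds if a_N² + a_{N−1}² ≤ λ_1. -/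
open Finset in
theorem Fin.sum_filter_val_lt_eq_sum_range {N p : ℕ} (hp : p ≤ N) (f : Fin N → ℝ) (g : ℕ → ℝ)
    (hfg : ∀ i : Fin N, f i = g i) :
    ∑ n ∈ univ.filter (fun n : Fin N => (n : ℕ) < p), f n = ∑ i ∈ range p, g i := by
  simp only [hfg, sum_filter]
  rw [Fin.sum_univ_eq_sum_range (fun i => if i < p then g i else 0) N, ← sum_filter]
  congr 1
  ext i
  simp only [mem_filter, mem_range]
  omega

open Finset in
/-- If consecutive pairs of `b`, counted from the end, are dominated by the terms of `l`, then the
partial sums of `b` overtake those of `l` from the end. -/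
theorem sum_range_le_sum_range_sub_two_mul {N M : ℕ} (hMN : 2 * M ≤ N) {b l : ℕ → ℝ}
    (hsum : ∑ i ∈ range N, b i = ∑ i ∈ range M, l i)
    (hpair : ∀ k < M, b (N - 2 * (M - k)) + b (N - 2 * (M - k) + 1) ≤ l k) {k : ℕ} (hk : k ≤ M) :
    ∑ i ∈ range k, l i ≤ ∑ i ∈ range (N - 2 * (M - k)), b i := by
  induction hk using Nat.decreasingInduction with
  | self => simp [hsum]
  | of_succ k hk ih =>
    have hidx : N - 2 * (M - (k + 1)) = N - 2 * (M - k) + 1 + 1 := by omega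
    rw [hidx, sum_range_succ, sum_range_succ, sum_range_succ] at ih
    linarith [hpair k hk]

open Finset in
theorem exists_greedy_partition {N M : ℕ} (hMN : 2 * M ≤ N) {b l : ℕ → ℝ}
    (hb : ∀ i, 0 < b i) (hbmono : ∀ i j, i ≤ j → j < N → b i ≤ b j) (hl : ∀ i, 0 < l i)
    (hsum : ∑ i ∈ range N, b i = ∑ i ∈ range M, l i)
    (hpair : ∀ k < M, b (N - 2 * (M - k)) + b (N - 2 * (M - k) + 1) ≤ l k) :
    ∃ q : ℕ → ℕ, q M = N ∧ (∀ k, q k ≤ N) ∧ ∀ k < M, q k + 2 ≤ q (k + 1) ∧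
      ∑ i ∈ range (q k), b i ≤ ∑ i ∈ range k, l i ∧
      ∑ i ∈ range k, l i < ∑ i ∈ range (q k + 1), b i := by
  have hS : StrictMono fun n => ∑ i ∈ range n, b i :=
    strictMono_nat_of_lt_succ fun n => by simp [sum_range_succ, hb n]
  let q : ℕ → ℕ := fun k =>
    Nat.findGreatest (fun n => ∑ i ∈ range n, b i ≤ ∑ i ∈ range k, l i) N
  have hqle (k) : q k ≤ N := Nat.findGreatest_le N
  have hqS (k) : ∑ i ∈ range (q k), b i ≤ ∑ i ∈ range k, l i :=
    Nat.findGreatest_spec (P := fun n => ∑ i ∈ range n, b i ≤ ∑ i ∈ range k, l i)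
      (Nat.zero_le N) (by simpa using sum_nonneg fun i _ => (hl i).le)
  have hle_q {n k} (hn : n ≤ N) (h : ∑ i ∈ range n, b i ≤ ∑ i ∈ range k, l i) : n ≤ q k :=
    Nat.le_findGreatest hn h
  refine ⟨q, le_antisymm (hqle M) (hle_q le_rfl hsum.le), hqle, fun k hk => ?_⟩
  have hqk : q k ≤ N - 2 * (M - k) := hS.le_iff_le.mp
    ((hqS k).trans (sum_range_le_sum_range_sub_two_mul hMN hsum hpair hk.le))
  refine ⟨hle_q (by omega) ?_, hqS k, ?_⟩
  · rw [sum_range_succ, sum_range_succ, sum_range_succ]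
    linarith [hqS k, hpair k hk, hbmono _ _ hqk (by omega),
      hbmono (q k + 1) (N - 2 * (M - k) + 1) (by omega) (by omega)]
  · by_contra! h
    have := hle_q (by omega) h
    omega

/-- non-decreasing sequences `a_1 ≤ … ≤ a_N` and `λ_1 ≤ … ≤ λ_M` with
`N ≥ 2M`, `Σ a_n² = Σ λ_m` and `a_{N−2L}² + a_{N−2L−1}² ≤ λ_{M−L}` for all `L = 0,…,M−1`
are Spectral Tetris ready.  (In particular this applies when `a_N² + a_{N−1}² ≤ λ_1`,
since the sequences are non-decreasing.) -/
theorem stmt_13 (M N : ℕ) (hM : 0 < M) (hMN : 2 * M ≤ N)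
    (a : Fin N → ℝ) (ha : ∀ n, 0 < a n) (hamono : Monotone a)
    (lam : Fin M → ℝ) (hlam : ∀ m, 0 < lam m) (hlmono : Monotone lam)
    (hsum : ∑ n, a n ^ 2 = ∑ m, lam m)
    (hcond : ∀ L : ℕ, ∀ hL : L < M,
      a ⟨N - 2 * L - 1, by omega⟩ ^ 2 + a ⟨N - 2 * L - 2, by omega⟩ ^ 2
        ≤ lam ⟨M - L - 1, by omega⟩) :
    SpectralTetrisReady a lam := by
  set b : ℕ → ℝ := fun i => if h : i < N then a ⟨i, h⟩ ^ 2 else 1 with hbdef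
  set l : ℕ → ℝ := fun i => if h : i < M then lam ⟨i, h⟩ else 1 with hldef
  have hab (i : Fin N) : a i ^ 2 = b i := by simp [hbdef]
  have hll (i : Fin M) : lam i = l i := by simp [hldef]
  have hb (i) : 0 < b i := by
    by_cases h : i < N
    · simpa [hbdef, h] using pow_pos (ha ⟨i, h⟩) 2
    · simp [hbdef, h]
  have hl (i) : 0 < l i := by
    by_cases h : i < M
    · simpa [hldef, h] using hlam ⟨i, h⟩
    · simp [hldef, h]
  have hbmono (i j) (hij : i ≤ j) (hj : j < N) : b i ≤ b j := by
    rw [← hab ⟨i, hij.trans_lt hj⟩, ← hab ⟨j, hj⟩]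
    exact pow_le_pow_left₀ (ha _).le (hamono hij) 2
  have hsum' : ∑ i ∈ Finset.range N, b i = ∑ i ∈ Finset.range M, l i := by
    rw [← Fin.sum_univ_eq_sum_range, ← Fin.sum_univ_eq_sum_range]
    simpa only [hab, hll] using hsum
  have hpair (k) (hk : k < M) : b (N - 2 * (M - k)) + b (N - 2 * (M - k) + 1) ≤ l k := by
    have h := hcond (M - k - 1) (by omega)
    simp only [hab, hll] at h
    rw [show N - 2 * (M - k - 1) - 1 = N - 2 * (M - k) + 1 by omega,
      show N - 2 * (M - k - 1) - 2 = N - 2 * (M - k) by omega,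
      show M - (M - k - 1) - 1 = k by omega] at h
    linarith
  obtain ⟨q, hqM, hqN, hq⟩ := exists_greedy_partition hMN hb hbmono hl hsum' hpair
  refine ⟨hsum, fun j => q (j + 1), ?_, fun k => hqN _, fun k hk => ?_, fun j hj => ?_⟩
  · have hmono : StrictMonoOn q (Set.Iic M) :=
      strictMonoOn_Iic_of_lt_succ fun k hk => by
        have := (hq k hk).1
        simp only [Nat.succ_eq_succ, Nat.succ_eq_add_one]
        omega
    exact fun i j hij => hmono i.isLt j.isLt (Nat.succ_lt_succ hij)
  · simp only [hk, Nat.sub_add_cancel hM, hqM]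
  · obtain ⟨hgap, hle, hlt⟩ := hq (j + 1) (by omega)
    have hqN' := hqN (j + 1 + 1)
    simp only [← Nat.lt_succ_iff (n := (j : ℕ)), Nat.succ_eq_add_one]
    rw [Fin.sum_filter_val_lt_eq_sum_range (by omega) _ b hab,
      Fin.sum_filter_val_lt_eq_sum_range (by omega) _ b hab,
      Fin.sum_filter_val_lt_eq_sum_range (by omega) _ l hll]
    refine ⟨hle, hlt, fun _ => ⟨by omega, fun h2 => ?_⟩⟩
    rw [Finset.sum_range_succ b] at hlt
    rw [hab]
    have hstep := hbmono _ _ (Nat.le_succ (q (j + 1))) h2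
    simp only [Nat.succ_eq_add_one] at hstep
    linarith
end

section
/- Let a_1 ≥ a_2 ≥ … ≥ a_N > 0 be real numbers and set λ = (1/M) Σ_{n=1}^N a_n². If a_1² + a_2² ≤ λ, then there exists a λ-tight frame {f_n}_{n=1}^N for ℝ^M (i.e., Σ_{n=1}^N ⟨x, f_n⟩ f_n = λ x for all x ∈ ℝ^M) satisfying ‖f_n‖ = a_n for all n = 1,…,N, with every frame vector 2-sparse with respect to the standard basis. -/
open scoped RealInnerProductSpace

/-- Two planar vectors of squared norms `b` and `c`, both exceeding `r`, can be chosen so that their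
first coordinates have square sum `r` and the two rows of coordinates are orthogonal. -/
lemma exists_orthogonal_rows_s14 {r b c : ℝ} (hr : 0 ≤ r) (hb : r < b) (hc : r < c) :
    ∃ x y z w : ℝ, x ^ 2 + y ^ 2 = r ∧ x ^ 2 + z ^ 2 = b ∧ y ^ 2 + w ^ 2 = c ∧
      x * z + y * w = 0 := by
  have hd : 0 < b + c - 2 * r := by linarith
  obtain ⟨s, hs⟩ : ∃ s, s = r * (c - r) / (b + c - 2 * r) := ⟨_, rfl⟩
  have hs' : s * (b + c - 2 * r) = r * (c - r) := by
    rw [hs, div_mul_cancel₀ _ hd.ne']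
  have hs0 : 0 ≤ s := by
    rw [hs]; exact div_nonneg (mul_nonneg hr (by linarith)) hd.le
  have hsr : s ≤ r := by
    rw [hs, div_le_iff₀ hd]; exact mul_le_mul_of_nonneg_left (by linarith) hr
  refine ⟨√s, √(r - s), √(b - s), -√(c - r + s), ?_, ?_, ?_, ?_⟩
  · rw [Real.sq_sqrt hs0, Real.sq_sqrt (by linarith)]; ring
  · rw [Real.sq_sqrt hs0, Real.sq_sqrt (by linarith)]; ring
  · rw [neg_sq, Real.sq_sqrt (by linarith), Real.sq_sqrt (by linarith)]; ring
  · rw [mul_neg, ← Real.sqrt_mul hs0, ← Real.sqrt_mul (by linarith),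
      show s * (b - s) = (r - s) * (c - r + s) by linarith]
    ring

/-- The spectral tetris construction: vectors with squared norms `b (n - 1), …, b 0`, placed in this
order, fill the coordinates `k, k - 1, …, 0` up to `r` in coordinate `k` and up to `lam` in the
others, each vector using only two adjacent coordinates. -/
lemma exists_spectral_tetris {lam : ℝ} (hlam : 0 < lam) {b : ℕ → ℝ} (hb : ∀ i, 0 < b i)
    (hmono : Antitone b) (hcond : b 0 + b 1 ≤ lam) (n k : ℕ) (r : ℝ) (hr : 0 ≤ r)
    (hrlam : r ≤ lam) (hsum : ∑ i ∈ Finset.range n, b i = r + k * lam) :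
    ∃ f : ℕ → ℕ → ℝ,
      (∀ p q, ∑ i ∈ Finset.range n, f i p * f i q =
        if p = q then (if p < k then lam else if p = k then r else 0) else 0) ∧
      ∀ i < n, ∃ u ≤ k, ∃ x y : ℝ, (u = 0 → y = 0) ∧ x ^ 2 + y ^ 2 = b i ∧
        ∀ p, f i p = if p = u then x else if p + 1 = u then y else 0 := by
  induction n using Nat.strong_induction_on generalizing k r with
  | _ n ih =>
    rcases n with _ | n
    · obtain rfl : k = 0 := by
        by_contra hk
        have : 0 < (k : ℝ) * lam := by positivity
        simp at hsum
        linarith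
      have hr0 : r = 0 := by simpa using hsum.symm
      exact ⟨0, by simp [hr0], by simp⟩
    rw [Finset.sum_range_succ] at hsum
    by_cases hbr : b n ≤ r
    · obtain ⟨g, hg, hgs⟩ := ih n (by omega) k (r - b n) (by linarith)
        (by linarith [hb n]) (by linarith)
      refine ⟨fun i => if i < n then g i else fun p => if p = k then √(b n) else 0, ?_, ?_⟩
      · intro p q
        have hsq := Real.mul_self_sqrt (hb n).le
        have hcongr : ∑ i ∈ Finset.range n,
            (if i < n then g i else fun p => if p = k then √(b n) else 0) p *
            (if i < n then g i else fun p => if p = k then √(b n) else 0) q =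
            ∑ i ∈ Finset.range n, g i p * g i q :=
          Finset.sum_congr rfl fun i hi => by simp [Finset.mem_range.1 hi]
        rw [Finset.sum_range_succ, hcongr, hg]
        simp only [lt_irrefl, if_false]
        grind
      · intro i hi
        by_cases hin : i < n
        · simpa [hin] using hgs i hin
        · obtain rfl : i = n := by omega
          exact ⟨k, le_rfl, √(b i), 0, by simp, by simp [Real.sq_sqrt (hb i).le], by simp⟩
    · push Not at hbr
      have hnn : ∀ j, 0 ≤ ∑ i ∈ Finset.range j, b i := fun j =>
        Finset.sum_nonneg fun i _ => (hb i).le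
      obtain ⟨k, rfl⟩ : ∃ j, k = j + 1 := by
        refine Nat.exists_eq_succ_of_ne_zero ?_
        rintro rfl
        have := hnn n
        simp at hsum
        linarith
      obtain ⟨n, rfl⟩ : ∃ j, n = j + 1 := by
        refine Nat.exists_eq_succ_of_ne_zero ?_
        rintro rfl
        have : 0 ≤ (k : ℝ) * lam := by positivity
        push_cast at hsum
        simp at hsum
        linarith [hb 1]
      have hle : b (n + 1) ≤ b n := hmono (Nat.le_succ n)
      have h0 : b n ≤ b 0 := hmono (Nat.zero_le n)
      have h1 : b (n + 1) ≤ b 1 := hmono (by omega)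
      obtain ⟨x, y, z, w, hxy, hxz, hyw, horth⟩ :=
        exists_orthogonal_rows_s14 hr hbr (hbr.trans_le hle)
      rw [Finset.sum_range_succ] at hsum
      push_cast at hsum
      obtain ⟨g, hg, hgs⟩ := ih n (by omega) k (lam - (b (n + 1) + b n - r)) (by linarith)
        (by linarith) (by linarith)
      refine ⟨fun i => if i < n then g i else if i = n
        then fun p => if p = k + 1 then y else if p + 1 = k + 1 then w else 0
        else fun p => if p = k + 1 then x else if p + 1 = k + 1 then z else 0, ?_, ?_⟩
      · intro p q
        rw [Finset.sum_range_succ, Finset.sum_range_succ,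
          Finset.sum_congr rfl (g := fun i => g i p * g i q)
            fun i hi => by simp [Finset.mem_range.1 hi], hg]
        simp only [lt_irrefl, if_false, if_true, show ¬ n + 1 < n by omega,
          show ¬ n + 1 = n by omega, Nat.add_right_cancel_iff]
        grind
      · intro i hi
        by_cases hin : i < n
        · obtain ⟨u, hu, h⟩ := hgs i hin
          exact ⟨u, by omega, by simpa [hin] using h⟩
        · obtain rfl | rfl : i = n ∨ i = n + 1 := by omega
          · exact ⟨k + 1, le_rfl, y, w, by simp, hyw, by simp⟩
          · exact ⟨k + 1, le_rfl, x, z, by simp, hxz, by simp⟩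

lemma sum_range_sq_of_adjacent_support {M u : ℕ} (hu : u < M) {x y : ℝ} (hy : u = 0 → y = 0) :
    ∑ p ∈ Finset.range M, (if p = u then x else if p + 1 = u then y else 0) ^ 2 =
      x ^ 2 + y ^ 2 := by
  rcases u with _ | v
  · simp [hy rfl, hu]
  · have h : ∀ p, (if p = v + 1 then x else if p + 1 = v + 1 then y else 0) ^ 2 =
        (if p = v + 1 then x ^ 2 else 0) + if p = v then y ^ 2 else 0 := by grind
    rw [Finset.sum_congr rfl fun p _ => h p, Finset.sum_add_distrib]
    simp [hu, (Nat.lt_succ_self v).trans hu]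

/-- if `a_1 ≥ … ≥ a_N > 0` and `λ = (1/M) Σ a_n²` satisfy `a_1² + a_2² ≤ λ`,
then there is a `λ`-tight frame of `N` vectors in `ℝ^M` with `‖f_n‖ = a_n`, all of whose
vectors are 2-sparse with respect to the standard basis. -/
theorem stmt_14 (M N : ℕ) (hM : 0 < M) (hN : 2 ≤ N)
    (a : Fin N → ℝ) (ha : ∀ n, 0 < a n) (hmono : Antitone a)
    (lam : ℝ) (hlam : lam = (∑ n, a n ^ 2) / (M : ℝ))
    (hcond : a ⟨0, by omega⟩ ^ 2 + a ⟨1, by omega⟩ ^ 2 ≤ lam) :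
    ∃ f : Fin N → EuclideanSpace ℝ (Fin M),
      Submodule.span ℝ (Set.range f) = ⊤ ∧
      (∀ x : EuclideanSpace ℝ (Fin M), ∑ n, ⟪x, f n⟫ • f n = lam • x) ∧
      (∀ n, ‖f n‖ = a n) ∧
      ∀ n, {m : Fin M | f n m ≠ 0}.ncard ≤ 2 := by
  have hlam0 : 0 < lam := by
    have := ha ⟨0, by omega⟩
    have := ha ⟨1, by omega⟩
    exact lt_of_lt_of_le (by positivity) hcond
  let b : ℕ → ℝ := fun i => a ⟨min i (N - 1), by omega⟩ ^ 2
  have hbval : ∀ i : Fin N, b i = a i ^ 2 := fun i => by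
    have : min (i : ℕ) (N - 1) = i := by omega
    simp [b, this]
  have hbmono : Antitone b := fun i j hij => by
    refine pow_le_pow_left₀ (ha _).le (hmono ?_) 2
    simp only [Fin.mk_le_mk]
    omega
  obtain ⟨g, hgram, hsupp⟩ := exists_spectral_tetris hlam0 (b := b) (fun i => pow_pos (ha _) 2)
    hbmono (by rwa [← hbval ⟨0, by omega⟩, ← hbval ⟨1, by omega⟩] at hcond) N (M - 1) lam
    hlam0.le le_rfl (by
      rw [Finset.sum_range]
      have hM' : (M : ℝ) ≠ 0 := by positivity
      simp only [hbval]
      rw [Nat.cast_sub hM, eq_div_iff hM'] at *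
      push_cast
      linarith)
  let f : Fin N → EuclideanSpace ℝ (Fin M) := fun n => WithLp.toLp 2 fun m => g n m
  have htight : ∀ x : EuclideanSpace ℝ (Fin M), ∑ n, ⟪x, f n⟫ • f n = lam • x := by
    intro x
    ext q
    have hrow : ∀ p : Fin M, ∑ n : Fin N, g n p * g n q = if p = q then lam else 0 := by
      intro p
      rw [← Finset.sum_range (fun i => g i p * g i q), hgram]
      grind
    calc (∑ n, ⟪x, f n⟫ • f n) q = ∑ n : Fin N, ∑ p, x p * (g n p * g n q) := by
          simp [f, PiLp.inner_apply, Finset.sum_mul]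
          refine Finset.sum_congr rfl fun n _ => Finset.sum_congr rfl fun p _ => by ring
      _ = ∑ p, x p * ∑ n : Fin N, g n p * g n q := by
          rw [Finset.sum_comm]
          simp only [Finset.mul_sum]
      _ = (lam • x) q := by
          simp only [hrow]
          simp [mul_comm]
  refine ⟨f, ?_, htight, ?_, ?_⟩
  · rw [eq_top_iff]
    intro x _
    have hx : x = lam⁻¹ • ∑ n, ⟪x, f n⟫ • f n := by
      rw [htight, inv_smul_smul₀ hlam0.ne']
    rw [hx]
    exact Submodule.smul_mem _ _ (Submodule.sum_mem _ fun n _ =>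
      Submodule.smul_mem _ _ (Submodule.subset_span ⟨n, rfl⟩))
  · intro n
    obtain ⟨u, hu, x, y, hy, hxy, hform⟩ := hsupp n n.2
    rw [EuclideanSpace.norm_eq, Real.sqrt_eq_iff_eq_sq (by positivity) (ha n).le, ← hbval n, ← hxy,
      ← sum_range_sq_of_adjacent_support (show u < M by omega) hy, Finset.sum_range]
    simp [f, hform]
  · intro n
    obtain ⟨u, hu, x, y, hy, hxy, hform⟩ := hsupp n n.2
    have hsub : {m : Fin M | f n m ≠ 0} ⊆
        {(⟨u, by omega⟩ : Fin M), (⟨u - 1, by omega⟩ : Fin M)} := by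
      intro m hm
      have hm' : g n m ≠ 0 := hm
      rw [hform] at hm'
      simp only [Set.mem_insert_iff, Set.mem_singleton_iff, Fin.ext_iff]
      grind
    exact (Set.ncard_le_ncard hsub (Set.toFinite _)).trans ((Set.ncard_insert_le _ _).trans (by simp))
end

section
/- Let {λ_m}_{m=1}^M ⊆ (0,∞) be a non-increasing sequence of positive real numbers. Then there exist a positive integer N and an equal-norm frame {f_n}_{n=1}^N for ℝ^M (i.e., ‖f_n‖ = ‖f_{n'}‖ for all n, n') whose frame operator has eigenvalues λ_1,…,λ_M (with multiplicity) and all of whose vectors are 2-sparse with respect to the standard basis. -/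
open scoped RealInnerProductSpace

/-- The alias decomposition: nonnegative numbers of average `c` are obtained by splitting, for each
index `k`, a mass `c` between `k` and a single other index `j k`. -/
theorem exists_alias_decomposition {ι : Type*} [DecidableEq ι] (c : ℝ) (s : Finset ι) (w : ι → ℝ)
    (hw : ∀ i ∈ s, 0 ≤ w i) (hsum : ∑ i ∈ s, w i = s.card * c) :
    ∃ (j : ι → ι) (p : ι → ℝ), ∀ m ∈ s, j m ∈ s ∧ 0 ≤ p m ∧ p m ≤ c ∧ (j m = m → p m = c) ∧
      w m = p m + ∑ k ∈ s, if j k = m then c - p k else 0 := by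
  induction hn : s.card generalizing s w with
  | zero =>
    rw [Finset.card_eq_zero] at hn
    subst hn
    exact ⟨id, w, by simp⟩
  | succ n ih =>
    have hne : s.Nonempty := by
      rw [← Finset.card_pos]; omega
    obtain ⟨i, hi, hic⟩ : ∃ i ∈ s, w i ≤ c :=
      Finset.exists_le_of_sum_le hne (by simp [hsum])
    have hcard : (s.erase i).card = n := by rw [Finset.card_erase_of_mem hi]; omega
    have hse : w i + ∑ k ∈ s.erase i, w k = (n + 1) * c := by
      rw [Finset.add_sum_erase _ _ hi, hsum, hn]; push_cast; ring
    rcases (s.erase i).eq_empty_or_nonempty with he | he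
    · have hs : s = {i} := by
        rw [← Finset.insert_erase hi, he]; rfl
      subst hs
      refine ⟨id, w, ?_⟩
      have h1 : w i = c := by simpa using hsum
      intro m hm
      rw [Finset.mem_singleton] at hm
      subst hm
      have h0 := hw m hi
      rw [h1] at h0
      simp [h1, h0]
    · obtain ⟨l, hl, hlc⟩ : ∃ l ∈ s.erase i, c ≤ w l := by
        refine Finset.exists_le_of_sum_le he ?_
        rw [Finset.sum_const, hcard, nsmul_eq_mul]
        linarith
      have hli : l ≠ i := Finset.ne_of_mem_erase hl
      have hwi := hw i hi
      obtain ⟨j, p, h⟩ := ih (s.erase i) (fun k => w k - if k = l then c - w i else 0)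
        (by
          intro k hk
          have := hw k (Finset.mem_of_mem_erase hk)
          split_ifs with hkl
          · subst hkl; linarith
          · linarith)
        (by
          rw [Finset.sum_sub_distrib, Finset.sum_ite_eq', if_pos hl, hcard]
          linarith) hcard
      refine ⟨Function.update j i l, Function.update p i (w i), fun m hm => ?_⟩
      have hsplit : (∑ k ∈ s, if Function.update j i l k = m
            then c - Function.update p i (w i) k else 0)
          = (if l = m then c - w i else 0) + ∑ k ∈ s.erase i, if j k = m then c - p k else 0 := by
        rw [← Finset.add_sum_erase _ _ hi]
        congr 1
        · simp
        · refine Finset.sum_congr rfl fun k hk => ?_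
          have := Finset.ne_of_mem_erase hk
          simp [Function.update_of_ne this]
      rw [hsplit]
      by_cases hmi : m = i
      · subst hmi
        have h0 : (∑ k ∈ s.erase m, if j k = m then c - p k else 0) = 0 :=
          Finset.sum_eq_zero fun k hk => if_neg (Finset.ne_of_mem_erase (h k hk).1)
        simp [h0, hli, hic, hwi, Finset.mem_of_mem_erase hl]
      · obtain ⟨h1, h2, h3, h4, h5⟩ := h m (Finset.mem_erase.2 ⟨hmi, hm⟩)
        rw [Function.update_of_ne hmi, Function.update_of_ne hmi]
        refine ⟨Finset.mem_of_mem_erase h1, h2, h3, h4, ?_⟩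
        simp only [eq_comm (a := m) (b := l)] at h5
        linarith

/-- Orthogonal unit vectors (or equal ones, with one zero coefficient) combine to a vector whose
squared norm is the sum of the squares of the coefficients. -/
theorem norm_sq_smul_single_add_smul_single {ι : Type*} [Fintype ι] [DecidableEq ι] (a b : ℝ)
    (i j : ι) (h : j = i → b = 0) :
    ‖a • EuclideanSpace.single i (1 : ℝ) + b • EuclideanSpace.single j (1 : ℝ)‖ ^ 2
      = a ^ 2 + b ^ 2 := by
  rw [norm_add_sq_real]
  by_cases hij : j = i
  · simp [h hij, norm_smul]
  · simp [norm_smul, inner_smul_left, inner_smul_right, EuclideanSpace.inner_single_left, Ne.symm hij]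

theorem stmt_15 (M : ℕ) (hM : 0 < M) (lam : Fin M → ℝ)
    (hlam : ∀ m, 0 < lam m) (hmono : Antitone lam) :
    ∃ (N : ℕ) (f : Fin N → EuclideanSpace ℝ (Fin M)),
      0 < N ∧
      Submodule.span ℝ (Set.range f) = ⊤ ∧
      (∀ n n', ‖f n‖ = ‖f n'‖) ∧
      (∃ b : OrthonormalBasis (Fin M) ℝ (EuclideanSpace ℝ (Fin M)),
        ∀ m, ∑ n, ⟪b m, f n⟫ • f n = lam m • b m) ∧
      ∀ n, {m : Fin M | f n m ≠ 0}.ncard ≤ 2 := by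
  have hM' : (M : ℝ) ≠ 0 := by positivity
  obtain ⟨j, p, h⟩ := exists_alias_decomposition ((∑ i, lam i) / M) Finset.univ lam
    (fun i _ => (hlam i).le) (by rw [Finset.card_univ, Fintype.card_fin]; field_simp)
  set c := (∑ i, lam i) / M
  let e : Fin M → EuclideanSpace ℝ (Fin M) := fun i => EuclideanSpace.single i (1 : ℝ)
  let a : Fin M → ℝ := fun k => √(p k / 2)
  let d : Fin M → ℝ := fun k => √((c - p k) / 2)
  have ha : ∀ k, a k ^ 2 = p k / 2 := fun k =>
    Real.sq_sqrt (by linarith [(h k (Finset.mem_univ k)).2.1])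
  have hd : ∀ k, d k ^ 2 = (c - p k) / 2 := fun k =>
    Real.sq_sqrt (by linarith [(h k (Finset.mem_univ k)).2.2.1])
  have hd0 : ∀ k, j k = k → d k = 0 := fun k hk => by
    simp [d, (h k (Finset.mem_univ k)).2.2.2.1 hk]
  let g : Fin M ⊕ Fin M → EuclideanSpace ℝ (Fin M) :=
    Sum.elim (fun k => a k • e k + d k • e (j k)) (fun k => a k • e k + (-d k) • e (j k))
  let f : Fin (M + M) → EuclideanSpace ℝ (Fin M) := g ∘ finSumFinEquiv.symm
  have hop : ∀ m, ∑ n, ⟪e m, f n⟫ • f n = lam m • e m := by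
    intro m
    have hterm : ∀ k, ⟪e m, g (.inl k)⟫ • g (.inl k) + ⟪e m, g (.inr k)⟫ • g (.inr k)
        = (if k = m then p k else 0) • e m + (if j k = m then c - p k else 0) • e m := by
      intro k
      have h1 : ∀ i, ⟪e m, e i⟫ = if i = m then (1 : ℝ) else 0 := by
        intro i
        simp [e, EuclideanSpace.inner_single_left, eq_comm]
      have h2 : ∀ i (x : ℝ), (if i = m then x else 0) • e m = (if i = m then x else 0) • e i := by
        intro i x
        split_ifs with hi
        · rw [hi]
        · simp
      rw [h2, h2]
      simp only [g, Sum.elim_inl, Sum.elim_inr, inner_add_right, inner_smul_right, h1]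
      have e1 : p k = 2 * a k ^ 2 := by rw [ha]; ring
      have e2 : c - p k = 2 * d k ^ 2 := by rw [hd]; ring
      rw [e2, e1]
      split_ifs <;> module
    calc ∑ n, ⟪e m, f n⟫ • f n = ∑ n, ⟪e m, g n⟫ • g n :=
          Equiv.sum_comp finSumFinEquiv.symm fun n => ⟪e m, g n⟫ • g n
      _ = lam m • e m := by
        rw [Fintype.sum_sum_type, ← Finset.sum_add_distrib, Finset.sum_congr rfl fun k _ => hterm k,
          Finset.sum_add_distrib, ← Finset.sum_smul, ← Finset.sum_smul, ← add_smul,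
          Finset.sum_ite_eq', if_pos (Finset.mem_univ m),
          ← (h m (Finset.mem_univ m)).2.2.2.2]
  have hnorm : ∀ n, ‖g n‖ ^ 2 = c / 2 := by
    rintro (k | k)
    · have := norm_sq_smul_single_add_smul_single (a k) (d k) k (j k) (hd0 k)
      simp only [g, Sum.elim_inl, e, this, ha, hd]
      ring
    · have := norm_sq_smul_single_add_smul_single (a k) (-d k) k (j k)
        fun hk => by rw [hd0 k hk, neg_zero]
      simp only [g, Sum.elim_inr, e, this, neg_sq, ha, hd]
      ring
  have hsparse : ∀ n, {m : Fin M | g n m ≠ 0}.ncard ≤ 2 := by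
    have key : ∀ (x y : ℝ) (i l : Fin M), {m : Fin M | (x • e i + y • e l) m ≠ 0}.ncard ≤ 2 := by
      intro x y i l
      refine (Set.ncard_le_ncard (t := {i, l}) ?_ (Set.toFinite _)).trans ((Set.ncard_insert_le i {l}).trans (by simp))
      intro m hm
      by_contra hcon
      simp only [Set.mem_insert_iff, Set.mem_singleton_iff, not_or] at hcon
      exact hm (by simp [e, hcon.1, hcon.2])
    rintro (k | k)
    · exact key _ _ _ _
    · exact key _ _ _ _
  refine ⟨M + M, f, by omega, ?_, fun n n' => ?_, ⟨EuclideanSpace.basisFun (Fin M) ℝ, ?_⟩,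
    fun n => hsparse _⟩
  · rw [eq_top_iff, ← (EuclideanSpace.basisFun (Fin M) ℝ).toBasis.span_eq, Submodule.span_le]
    rintro _ ⟨m, rfl⟩
    have hm : e m = (lam m)⁻¹ • ∑ n, ⟪e m, f n⟫ • f n := by
      rw [hop, inv_smul_smul₀ (hlam m).ne']
    have hmem : e m ∈ Submodule.span ℝ (Set.range f) := by
      rw [hm]
      exact Submodule.smul_mem _ _ (Submodule.sum_mem _ fun n _ =>
        Submodule.smul_mem _ _ (Submodule.subset_span ⟨n, rfl⟩))
    simpa [e] using hmem
  · exact (pow_left_inj₀ (norm_nonneg _) (norm_nonneg _) two_ne_zero).1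
      ((hnorm _).trans (hnorm _).symm)
  · intro m
    simpa only [EuclideanSpace.basisFun_apply] using hop m
end
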